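/- arXiv:2602.23535 — 9 statements merged into one kernel-verified Lean document; each statement's English description precedes it below -/
import Mathlib

section
/- There is a universal constant C ≥ 1 with the following property. Let μ, ν be probability measures on a measurable space X with ν ≪ μ and r = dν/dμ, let 0 < ε < 1 and 0 < δ < 1, and let M > 0 satisfy ICov_M(ν‖μ) ≤ ε·M/C. Then for every n ≥ C·M·log(1/δ)/ε there exists a measurable function Ẑ : ℝⁿ → ℝ such that for every Z > 0, the probability under μ^{⊗n} that (1−ε)·Z ≤ Ẑ(Z·r(X₁), …, Z·r(X_n)) ≤ (1+ε)·Z is at least 1 − δ. -/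
open MeasureTheory Real
open scoped ENNReal

/-- `rnd μ ν` is the Radon–Nikodym derivative `dν/dμ`, as a real-valued function. -/
noncomputable def rnd {X : Type*} [MeasurableSpace X] (μ ν : Measure X) (x : X) : ℝ :=
  (ν.rnDeriv μ x).toReal

/-- Coverage at level `M`: `Cov_M(ν‖μ) = ν {x | dν/dμ (x) ≥ M}`. -/
noncomputable def Cov {X : Type*} [MeasurableSpace X] (μ ν : Measure X) (M : ℝ) : ℝ :=
  (ν {x | M ≤ rnd μ ν x}).toReal

/-- Integrated coverage: `ICov_M(ν‖μ) = ∫₀^M Cov_t(ν‖μ) dt`. -/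
noncomputable def ICov {X : Type*} [MeasurableSpace X] (μ ν : Measure X) (M : ℝ) : ℝ :=
  ∫ t in (0:ℝ)..M, Cov μ ν t


theorem chernoff {X : Type} [MeasurableSpace X] (μ : Measure X) [IsProbabilityMeasure μ]
    (n : ℕ) (g : X → ℝ) (hg : Measurable g) (hb : ∀ x, |g x| ≤ 1) (B a : ℝ)
    (hB : ∫ x, g x ∂μ + ∫ x, g x ^ 2 ∂μ ≤ B) :
    (Measure.pi fun _ : Fin n => μ).real {ω | a ≤ ∑ i, g (ω i)} ≤ Real.exp (n * B - a) := by
  have hgi : Integrable g μ := Integrable.of_bound hg.aestronglyMeasurable 1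
    (ae_of_all _ fun x => by simpa using hb x)
  have hg2 : Integrable (fun x => g x ^ 2) μ :=
    Integrable.of_bound (hg.pow_const 2).aestronglyMeasurable 1
    (ae_of_all _ fun x => by
      have := hb x
      simpa using (sq_le_one_iff_abs_le_one _).2 this)
  have hei : Integrable (fun x => Real.exp (g x)) μ :=
    Integrable.of_bound hg.exp.aestronglyMeasurable (Real.exp 1)
    (ae_of_all _ fun x => by
      rw [Real.norm_eq_abs, abs_of_pos (Real.exp_pos _)]
      exact Real.exp_le_exp.2 ((le_abs_self _).trans (hb x)))
  have h1 : ∫ x, Real.exp (g x) ∂μ ≤ Real.exp B := by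
    calc ∫ x, Real.exp (g x) ∂μ ≤ ∫ x, (1 + g x + g x ^ 2) ∂μ := by
          apply integral_mono hei
          · exact ((integrable_const _).add hgi).add hg2
          · intro x
            have := (abs_le.1 (Real.abs_exp_sub_one_sub_id_le (hb x))).2
            simp only
            linarith
      _ = 1 + ∫ x, g x ∂μ + ∫ x, g x ^ 2 ∂μ := by
          rw [integral_add (f := fun x => 1 + g x) ((integrable_const _).add hgi) hg2,
            integral_add (integrable_const _) hgi]
          simp
      _ ≤ B + 1 := by linarith
      _ ≤ Real.exp B := Real.add_one_le_exp B
  have hpi : Integrable (fun ω : Fin n → X => ∏ i, Real.exp (g (ω i)))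
      (Measure.pi fun _ : Fin n => μ) :=
    Integrable.fintype_prod (f := fun _ x => Real.exp (g x)) (fun _ => hei)
  have h2 := mul_meas_ge_le_integral_of_nonneg
    (ae_of_all _ fun ω => Finset.prod_nonneg fun i _ => (Real.exp_pos _).le) hpi (Real.exp a)
  rw [integral_fintype_prod_eq_pow (fun x => Real.exp (g x))] at h2
  have hset : {ω : Fin n → X | Real.exp a ≤ ∏ i, Real.exp (g (ω i))}
      = {ω | a ≤ ∑ i, g (ω i)} := by
    ext ω
    simp only [Set.mem_ofPred_eq, ← Real.exp_sum, Real.exp_le_exp]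
  rw [hset] at h2
  have h3 : (∫ x, Real.exp (g x) ∂μ) ^ (Fintype.card (Fin n)) ≤ Real.exp (n * B) := by
    rw [Real.exp_nat_mul, Fintype.card_fin]
    exact pow_le_pow_left₀ (integral_nonneg fun x => (Real.exp_pos _).le) h1 n
  rw [Real.exp_sub, le_div_iff₀ (Real.exp_pos a), mul_comm]
  exact h2.trans h3

theorem measurable_rnd {X : Type} [MeasurableSpace X] (μ ν : Measure X) :
    Measurable (rnd μ ν) := (Measure.measurable_rnDeriv ν μ).ennreal_toReal

theorem rnd_nonneg {X : Type} [MeasurableSpace X] (μ ν : Measure X) (x : X) :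
    0 ≤ rnd μ ν x := ENNReal.toReal_nonneg

section
variable {X : Type} [MeasurableSpace X] {μ ν : Measure X}
    [IsProbabilityMeasure μ] [IsProbabilityMeasure ν]

theorem integrable_rnd : Integrable (rnd μ ν) μ := Measure.integrable_toReal_rnDeriv

theorem integral_rnd (h : ν ≪ μ) : ∫ x, rnd μ ν x ∂μ = 1 := by
  have := Measure.integral_toReal_rnDeriv h
  simpa [rnd] using this

theorem setIntegral_rnd (h : ν ≪ μ) (s : Set X) : ∫ x in s, rnd μ ν x ∂μ = ν.real s :=
  Measure.setIntegral_toReal_rnDeriv h s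

theorem icov_eq {M : ℝ} (hM : 0 < M) : ICov μ ν M = ∫ x, min (rnd μ ν x) M ∂ν := by
  have hi : Integrable (fun x => min (rnd μ ν x) M) ν :=
    Integrable.of_bound ((measurable_rnd μ ν).min measurable_const).aestronglyMeasurable M
      (ae_of_all _ fun x => by
        rw [Real.norm_eq_abs, abs_of_nonneg (le_min (rnd_nonneg _ _ _) hM.le)]
        exact min_le_right _ _)
  rw [hi.integral_eq_integral_Ioc_meas_le (M := M)
    (ae_of_all _ fun x => le_min (rnd_nonneg _ _ _) hM.le) (ae_of_all _ fun x => min_le_right _ _),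
    ICov, intervalIntegral.integral_of_le hM.le]
  apply setIntegral_congr_fun measurableSet_Ioc
  intro t ht
  simp only [Cov, Measure.real]
  congr 2
  ext x
  simp [ht.2]

theorem change (h : ν ≪ μ) (f : X → ℝ) : ∫ x, rnd μ ν x * f x ∂μ = ∫ x, f x ∂ν := by
  have := integral_rnDeriv_smul h (f := f)
  simpa [rnd] using this

theorem nu_le (h : ν ≪ μ) (s : Set X) (hs : MeasurableSet s) (b : ℝ)
    (hb : ∀ x ∈ s, rnd μ ν x ≤ b) : ν.real s ≤ b * μ.real s := by
  rw [← setIntegral_rnd h s]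
  calc ∫ x in s, rnd μ ν x ∂μ ≤ ∫ x in s, b ∂μ :=
        setIntegral_mono_on integrable_rnd.integrableOn (integrable_const _).integrableOn hs hb
    _ = b * μ.real s := by simp [mul_comm]

theorem nu_ge (h : ν ≪ μ) (s : Set X) (hs : MeasurableSet s) (b : ℝ)
    (hb : ∀ x ∈ s, b ≤ rnd μ ν x) : b * μ.real s ≤ ν.real s := by
  rw [← setIntegral_rnd h s]
  calc b * μ.real s = ∫ x in s, b ∂μ := by simp [mul_comm]
    _ ≤ ∫ x in s, rnd μ ν x ∂μ :=
        setIntegral_mono_on (integrable_const _).integrableOn integrable_rnd.integrableOn hs hb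

/-- tail bound -/
theorem tail {M K : ℝ} (hM : 0 < M) (hKM : K ≤ M) :
    K * ν.real {x | K ≤ rnd μ ν x} ≤ ICov μ ν M := by
  rw [icov_eq hM]
  have hi : Integrable (fun x => min (rnd μ ν x) M) ν :=
    Integrable.of_bound ((measurable_rnd μ ν).min measurable_const).aestronglyMeasurable M
      (ae_of_all _ fun x => by
        rw [Real.norm_eq_abs, abs_of_nonneg (le_min (rnd_nonneg _ _ _) hM.le)]
        exact min_le_right _ _)
  have := mul_meas_ge_le_integral_of_nonneg
    (ae_of_all _ fun x => le_min (rnd_nonneg μ ν x) hM.le) hi K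
  simpa [hKM] using this

theorem second (h : ν ≪ μ) {M : ℝ} (hM : 0 < M) (f : X → ℝ)
    (h0 : ∀ x, 0 ≤ f x) (h1 : ∀ x, f x ≤ min (rnd μ ν x) M) :
    ∫ x, f x ^ 2 ∂μ ≤ ICov μ ν M := by
  rw [icov_eq hM, ← change h]
  apply integral_mono_of_nonneg
  · exact ae_of_all _ fun x => sq_nonneg _
  · apply Integrable.mul_bdd (c := M) integrable_rnd
    · exact ((measurable_rnd μ ν).min measurable_const).aestronglyMeasurable
    · exact ae_of_all _ fun x => by
        rw [Real.norm_eq_abs, abs_of_nonneg (le_min (rnd_nonneg _ _ _) hM.le)]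
        exact min_le_right _ _
  · refine ae_of_all _ fun x => ?_
    simp only
    rw [sq]
    exact mul_le_mul ((h1 x).trans (min_le_left _ _)) (h1 x) (h0 x) (rnd_nonneg _ _ _)

/-- first moment of truncation -/
theorem first (h : ν ≪ μ) {M : ℝ} (hM : 0 < M) :
    1 - ICov μ ν M / M ≤ ∫ x, min (rnd μ ν x) M ∂μ := by
  have hm : MeasurableSet {x | M ≤ rnd μ ν x} := measurableSet_le measurable_const (measurable_rnd μ ν)
  have ht := tail (μ := μ) (ν := ν) hM le_rfl
  have h1 : ν.real {x | M ≤ rnd μ ν x} ≤ ICov μ ν M / M := by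
    rw [le_div_iff₀ hM]; linarith
  have h2 : ν.real {x | M ≤ rnd μ ν x}ᶜ = 1 - ν.real {x | M ≤ rnd μ ν x} := by
    rw [measureReal_compl hm]; simp
  have hi : Integrable (fun x => min (rnd μ ν x) M) μ :=
    Integrable.of_bound ((measurable_rnd μ ν).min measurable_const).aestronglyMeasurable M
      (ae_of_all _ fun x => by
        rw [Real.norm_eq_abs, abs_of_nonneg (le_min (rnd_nonneg _ _ _) hM.le)]
        exact min_le_right _ _)
  have h3 : ν.real {x | M ≤ rnd μ ν x}ᶜ ≤ ∫ x, min (rnd μ ν x) M ∂μ := by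
    rw [← setIntegral_rnd h]
    calc _ = ∫ x in {x | M ≤ rnd μ ν x}ᶜ, min (rnd μ ν x) M ∂μ := by
          apply setIntegral_congr_fun hm.compl
          intro x hx
          simp only [Set.mem_compl_iff, Set.mem_ofPred_eq, not_le] at hx
          simp [hx.le]
      _ ≤ _ := setIntegral_le_integral hi (ae_of_all _ fun x => le_min (rnd_nonneg _ _ _) hM.le)
  linarith

theorem geom_bins (h : ν ≪ μ) {L K ε : ℝ} (hL : 0 < L) (hK : 0 < K) (hε : 0 < ε) (hε1 : ε < 1)
    (hν : 1 / 4 ≤ ν.real {x | L ≤ rnd μ ν x ∧ rnd μ ν x < K}) :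
    ∃ a, L ≤ a ∧ ε / (32 * K) ≤ μ.real {x | a ≤ rnd μ ν x ∧ rnd μ ν x < a * (1 + ε)} := by
  by_contra! hc
  set p := ε / (32 * K) with hp
  have hp0 : 0 < p := by positivity
  have hr := measurable_rnd μ ν
  have ind : ∀ J : ℕ, ν.real {x | L ≤ rnd μ ν x ∧ rnd μ ν x < L * (1 + ε) ^ J}
      ≤ p * (1 + ε) * (L * (1 + ε) ^ J) / ε := by
    intro J
    induction J with
    | zero =>
      have : {x | L ≤ rnd μ ν x ∧ rnd μ ν x < L * (1 + ε) ^ 0} = ∅ := by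
        ext x; simp
      rw [this]; simp; positivity
    | succ J ih =>
      set A := L * (1 + ε) ^ J with hA
      have hA2 : L * (1 + ε) ^ (J + 1) = A * (1 + ε) := by rw [hA]; ring
      rw [hA2]
      have hLA : L ≤ A := le_mul_of_one_le_right hL.le (one_le_pow₀ (by linarith))
      have hm : MeasurableSet {x | A ≤ rnd μ ν x ∧ rnd μ ν x < A * (1 + ε)} :=
        (measurableSet_le measurable_const hr).inter (measurableSet_lt hr measurable_const)
      have h1 := nu_le h _ hm (A * (1 + ε)) (fun x hx => hx.2.le)
      have h2 := hc A hLA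
      have h3 : ν.real {x | L ≤ rnd μ ν x ∧ rnd μ ν x < A * (1 + ε)} ≤
          ν.real {x | L ≤ rnd μ ν x ∧ rnd μ ν x < A}
          + ν.real {x | A ≤ rnd μ ν x ∧ rnd μ ν x < A * (1 + ε)} := by
        refine le_trans (measureReal_mono ?_) (measureReal_union_le _ _)
        rintro x ⟨hx1, hx2⟩
        rcases lt_or_ge (rnd μ ν x) A with h | h
        · exact Or.inl ⟨hx1, h⟩
        · exact Or.inr ⟨h, hx2⟩
      have h4 : A * (1 + ε) * μ.real {x | A ≤ rnd μ ν x ∧ rnd μ ν x < A * (1 + ε)}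
          ≤ A * (1 + ε) * p := mul_le_mul_of_nonneg_left h2.le (by positivity)
      have h5 : p * (1 + ε) * (A * (1 + ε)) / ε = p * (1 + ε) * A / ε + A * (1 + ε) * p := by
        field_simp
      linarith
  have hLK : L ≤ K := by
    by_contra! hlt
    have : {x | L ≤ rnd μ ν x ∧ rnd μ ν x < K} = ∅ := by
      ext x; simp; intro; linarith
    rw [this] at hν
    simp at hν
    linarith
  obtain ⟨J, hJ1, hJ2⟩ := exists_nat_pow_near (x := K / L) (y := 1 + ε)
    ((one_le_div hL).2 hLK) (by linarith)
  rw [le_div_iff₀ hL] at hJ1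
  rw [div_lt_iff₀ hL] at hJ2
  have h6 := ind (J + 1)
  have h7 : ν.real {x | L ≤ rnd μ ν x ∧ rnd μ ν x < K} ≤
    ν.real {x | L ≤ rnd μ ν x ∧ rnd μ ν x < L * (1 + ε) ^ (J + 1)} := by
    refine measureReal_mono ?_ (measure_ne_top _ _)
    rintro x ⟨hx1, hx2⟩
    exact ⟨hx1, by linarith⟩
  have h8 : L * (1 + ε) ^ (J + 1) ≤ 2 * K := by
    have : L * (1 + ε) ^ (J + 1) = ((1 + ε) ^ J * L) * (1 + ε) := by ring
    rw [this]
    nlinarith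
  have h9 : p * (1 + ε) * (L * (1 + ε) ^ (J + 1)) / ε ≤ p * 2 * (2 * K) / ε := by
    have : 1 + ε ≤ 2 := by linarith
    gcongr
  have h10 : p * 2 * (2 * K) / ε = 1 / 8 := by
    rw [hp]; field_simp; norm_num
  linarith

end

theorem window {Ω : Type} [MeasurableSpace Ω] (P : Measure Ω) [IsProbabilityMeasure P]
    (S : Ω → ℝ) {a b ε p q : ℝ} (ha : 0 < a) (hab : a ≤ b) (hε : 0 < ε) (hq : 0 < q)
    (hp : p ≤ P.real {ω | a ≤ S ω ∧ S ω ≤ b}) (hpq : q * ((b - a) / (ε * a) + 1) ≤ p) :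
    ∃ s, 0 < s ∧ q ≤ P.real {ω | s ≤ S ω ∧ S ω ≤ (1 + ε) * s} := by
  by_contra! hc
  have hea : 0 < ε * a := by positivity
  set N := ⌊(b - a) / (ε * a)⌋₊ + 1 with hN
  have hsub : {ω | a ≤ S ω ∧ S ω ≤ b} ⊆ ⋃ k ∈ Finset.range N,
      {ω | a + k * (ε * a) ≤ S ω ∧ S ω ≤ (1 + ε) * (a + k * (ε * a))} := by
    rintro ω ⟨h1, h2⟩
    simp only [Set.mem_iUnion, Finset.mem_range, Set.mem_ofPred_eq]
    have h0 : 0 ≤ (S ω - a) / (ε * a) := div_nonneg (by linarith) hea.le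
    refine ⟨⌊(S ω - a) / (ε * a)⌋₊, ?_, ?_, ?_⟩
    · rw [hN, Nat.lt_succ_iff]
      apply Nat.floor_mono
      gcongr
    · have := Nat.floor_le h0
      rw [le_div_iff₀ hea] at this
      linarith
    · have := (Nat.lt_floor_add_one ((S ω - a) / (ε * a))).le
      rw [div_le_iff₀ hea] at this
      have : 0 ≤ ε * (⌊(S ω - a) / (ε * a)⌋₊ * (ε * a)) := by positivity
      linarith
  have h1 := (measureReal_mono (μ := P) hsub (measure_ne_top _ _)).trans (measureReal_biUnion_finset_le _ _)
  have h2 : ∑ k ∈ Finset.range N,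
      P.real {ω | a + k * (ε * a) ≤ S ω ∧ S ω ≤ (1 + ε) * (a + k * (ε * a))} <
      ∑ k ∈ Finset.range N, q :=
    Finset.sum_lt_sum_of_nonempty ⟨0, by simp [hN]⟩ fun k _ => hc _ (by positivity)
  rw [Finset.sum_const, Finset.card_range, nsmul_eq_mul] at h2
  have h3 : (N : ℝ) ≤ (b - a) / (ε * a) + 1 := by
    rw [hN]; push_cast
    have := Nat.floor_le (div_nonneg (sub_nonneg.2 hab) hea.le)
    linarith
  have : (N : ℝ) * q ≤ q * ((b - a) / (ε * a) + 1) := by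
    rw [mul_comm]; gcongr
  linarith

section
variable {X : Type} [MeasurableSpace X] {μ ν : Measure X}
    [IsProbabilityMeasure μ] [IsProbabilityMeasure ν]

theorem of_sum {n : ℕ} {ε q s : ℝ} (hε : 0 < ε) (hs : 0 < s)
    (hq : q ≤ (Measure.pi fun _ : Fin n => μ).real
      {ω | s ≤ ∑ i, rnd μ ν (ω i) ∧ ∑ i, rnd μ ν (ω i) ≤ (1 + ε) * s}) :
    ∃ Zhat : (Fin n → ℝ) → ℝ, Measurable Zhat ∧ ∀ Z : ℝ, 0 < Z →
      q ≤ (Measure.pi fun _ : Fin n => μ).real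
        {ω | (1 - ε) * Z ≤ Zhat (fun i => Z * rnd μ ν (ω i)) ∧
             Zhat (fun i => Z * rnd μ ν (ω i)) ≤ (1 + ε) * Z} := by
  refine ⟨fun y => (∑ i, y i) / s, by fun_prop, fun Z hZ => hq.trans ?_⟩
  refine measureReal_mono ?_ (measure_ne_top _ _)
  rintro ω ⟨h1, h2⟩
  simp only [Set.mem_ofPred_eq, ← Finset.mul_sum]
  rw [le_div_iff₀ hs, div_le_iff₀ hs]
  constructor
  · have : Z * s ≤ Z * ∑ i, rnd μ ν (ω i) := by gcongr
    have : 0 < ε * Z * s := by positivity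
    linarith
  · have : Z * ∑ i, rnd μ ν (ω i) ≤ Z * ((1 + ε) * s) := by gcongr
    linarith

theorem trunc_bounds (M : ℝ) (hM : 0 < M) (x : X) :
    0 ≤ min (rnd μ ν x) M / M ∧ min (rnd μ ν x) M / M ≤ 1 :=
  ⟨div_nonneg (le_min (rnd_nonneg _ _ _) hM.le) hM.le, (div_le_one hM).2 (min_le_right _ _)⟩

/-- upper tail for a truncated quantity -/
theorem upper (h : ν ≪ μ) {M : ℝ} (hM : 0 < M) (n : ℕ) (f : X → ℝ) (hf : Measurable f)
    (h0 : ∀ x, 0 ≤ f x) (h1 : ∀ x, f x ≤ min (rnd μ ν x) M) (e t : ℝ)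
    (he : ∫ x, f x ∂μ ≤ e) :
    (Measure.pi fun _ : Fin n => μ).real {ω | t ≤ ∑ i, f (ω i)} ≤
      Real.exp ((n * (e + ICov μ ν M / M) - t) / M) := by
  have hc := chernoff μ n (fun x => f x / M) (hf.div_const M) (fun x => by
    rw [abs_of_nonneg (div_nonneg (h0 x) hM.le), div_le_one hM]
    exact (h1 x).trans (min_le_right _ _)) ((e + ICov μ ν M / M) / M) (t / M) (by
      simp only [div_pow]
      rw [integral_div, integral_div, add_div]
      have := second h hM f h0 h1
      have : (∫ x, f x ^ 2 ∂μ) / M ^ 2 ≤ ICov μ ν M / M / M := by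
        rw [div_div, ← sq]; gcongr
      have : (∫ x, f x ∂μ) / M ≤ e / M := by gcongr
      linarith)
  have hset : {ω : Fin n → X | t / M ≤ ∑ i, f (ω i) / M} = {ω | t ≤ ∑ i, f (ω i)} := by
    ext ω
    simp only [Set.mem_ofPred_eq, ← Finset.sum_div]
    exact div_le_div_iff_of_pos_right hM
  rw [hset] at hc
  convert hc using 2
  ring

theorem lower (h : ν ≪ μ) {M : ℝ} (hM : 0 < M) (n : ℕ) (t : ℝ) :
    (Measure.pi fun _ : Fin n => μ).real {ω | ∑ i, min (rnd μ ν (ω i)) M ≤ t} ≤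
      Real.exp ((t - n * (1 - 2 * (ICov μ ν M / M))) / M) := by
  have hr := measurable_rnd μ ν
  have hc := chernoff μ n (fun x => -(min (rnd μ ν x) M / M)) (by fun_prop) (fun x => by
    rw [abs_neg, abs_of_nonneg (trunc_bounds M hM x).1]
    exact (trunc_bounds M hM x).2) (-(1 - 2 * (ICov μ ν M / M)) / M) (-(t / M)) (by
      simp only [neg_sq, div_pow]
      rw [integral_neg, integral_div, integral_div]
      have := second h hM (fun x => min (rnd μ ν x) M)
        (fun x => le_min (rnd_nonneg _ _ _) hM.le) (fun x => le_rfl)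
      have : (∫ x, (min (rnd μ ν x) M) ^ 2 ∂μ) / M ^ 2 ≤ ICov μ ν M / M / M := by
        rw [div_div, ← sq]; gcongr
      have : (1 - ICov μ ν M / M) / M ≤ (∫ x, min (rnd μ ν x) M ∂μ) / M := by
        have := first h hM
        gcongr
      have e1 : -(1 - 2 * (ICov μ ν M / M)) / M =
        -((1 - ICov μ ν M / M) / M) + ICov μ ν M / M / M := by ring
      linarith)
  have hset : {ω : Fin n → X | -(t / M) ≤ ∑ i, -(min (rnd μ ν (ω i)) M / M)} =
      {ω | ∑ i, min (rnd μ ν (ω i)) M ≤ t} := by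
    ext ω
    simp only [Set.mem_ofPred_eq, Finset.sum_neg_distrib, ← Finset.sum_div, neg_le_neg_iff]
    exact div_le_div_iff_of_pos_right hM
  rw [hset] at hc
  convert hc using 2
  ring

theorem exp_neg_two : Real.exp (-2) ≤ 1 / 4 := by
  have h1 : Real.exp (-1) ≤ 1 / 2 := by
    rw [Real.exp_neg, inv_le_comm₀ (Real.exp_pos 1) (by norm_num)]
    have := Real.add_one_le_exp (1:ℝ)
    norm_num at this ⊢; exact this
  have : Real.exp (-2) = Real.exp (-1) * Real.exp (-1) := by rw [← Real.exp_add]; norm_num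
  rw [this]
  nlinarith [Real.exp_pos (-1)]

theorem caseA (h : ν ≪ μ) {ε M : ℝ} (hε : 0 < ε) (hε1 : ε < 1) (hM : 0 < M)
    (hI : ICov μ ν M ≤ ε * M / 4096) (n : ℕ) (hn : 16 * M ≤ ε * n) :
    ∃ Zhat : (Fin n → ℝ) → ℝ, Measurable Zhat ∧ ∀ Z : ℝ, 0 < Z →
      1 - Real.exp (-(ε * n / (4096 * M))) ≤ (Measure.pi fun _ : Fin n => μ).real
        {ω | (1 - ε) * Z ≤ Zhat (fun i => Z * rnd μ ν (ω i)) ∧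
             Zhat (fun i => Z * rnd μ ν (ω i)) ≤ (1 + ε) * Z} := by
  classical
  have hr := measurable_rnd μ ν
  set θ : ℝ := (1 - ε / 4) * n with hθ
  have hIM : ICov μ ν M / M ≤ ε / 4096 := by
    rw [div_le_iff₀ hM]; linarith
  refine ⟨fun y => ⨆ q : ℚ, if 0 < (q : ℝ) ∧ θ ≤ ∑ i, min (y i / q) M then (q : ℝ) else 0, ?_, ?_⟩
  · refine Measurable.iSup fun q => ?_
    refine Measurable.ite ?_ measurable_const measurable_const
    have hm : MeasurableSet ({y : Fin n → ℝ | 0 < (q : ℝ)} ∩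
        {y : Fin n → ℝ | θ ≤ ∑ i, min (y i / q) M}) :=
      MeasurableSet.inter (MeasurableSet.const _) (measurableSet_le measurable_const (by fun_prop))
    exact hm
  intro Z hZ
  set P := (Measure.pi fun _ : Fin n => μ) with hP
  set U : Set (Fin n → X) := {ω | θ ≤ ∑ i, min (rnd μ ν (ω i) / (1 + ε)) M} with hU
  set D : Set (Fin n → X) := {ω | ∑ i, min (rnd μ ν (ω i)) M ≤ θ} with hD
  have hUm : MeasurableSet U := measurableSet_le measurable_const (by fun_prop)
  have hDm : MeasurableSet D := measurableSet_le (by fun_prop) measurable_const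
  have h1ε : 1 ≤ 1 + ε := by linarith
  have hPU : P.real U ≤ Real.exp (-(ε * n / M) / 8) := by
    have := upper h hM n (fun x => min (rnd μ ν x / (1 + ε)) M) (by fun_prop)
      (fun x => le_min (div_nonneg (rnd_nonneg _ _ _) (by linarith)) hM.le)
      (fun x => min_le_min_right _ (div_le_self (rnd_nonneg _ _ _) h1ε)) (1 / (1 + ε)) θ (by
        have e0 : (1 : ℝ) / (1 + ε) = ∫ x, rnd μ ν x / (1 + ε) ∂μ := by
          rw [integral_div, integral_rnd h]
        rw [e0]
        refine integral_mono_of_nonneg (ae_of_all _ fun x =>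
          le_min (div_nonneg (rnd_nonneg _ _ _) (by linarith)) hM.le)
          (integrable_rnd.div_const _) (ae_of_all _ fun x => min_le_left _ _))
    refine this.trans (Real.exp_le_exp.2 ?_)
    have e1 : 1 / (1 + ε) ≤ 1 - ε / 2 := by
      rw [div_le_iff₀ (by linarith)]; nlinarith
    have e2 : n * (1 / (1 + ε) + ICov μ ν M / M) ≤ n * (1 - ε / 2 + ε / 4096) := by gcongr
    have e3 : -(ε * n / M) / 8 = (- (ε * n) / 8) / M := by ring
    rw [e3]
    have : 0 ≤ ε * n := by positivity
    apply div_le_div_of_nonneg_right _ hM.le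
    rw [hθ]
    linarith
  have hPD : P.real D ≤ Real.exp (-(ε * n / M) / 8) := by
    refine (lower h hM n θ).trans (Real.exp_le_exp.2 ?_)
    have e2 : n * (1 - 2 * (ε / 4096)) ≤ n * (1 - 2 * (ICov μ ν M / M)) := by gcongr
    have e3 : -(ε * n / M) / 8 = (- (ε * n) / 8) / M := by ring
    rw [e3]
    have : 0 ≤ ε * n := by positivity
    apply div_le_div_of_nonneg_right _ hM.le
    rw [hθ]
    linarith
  have hu : 16 ≤ ε * n / M := by rw [le_div_iff₀ hM]; exact hn
  have hexp : 2 * Real.exp (-(ε * n / M) / 8) ≤ Real.exp (-(ε * n / (4096 * M))) := by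
    have e1 : -(ε * n / (4096 * M)) = -(ε * n / M) / 4096 := by ring
    rw [e1]
    set u := ε * n / M
    have h2 : 2 ≤ Real.exp 1 := by
      have := Real.add_one_le_exp (1:ℝ); linarith
    calc 2 * Real.exp (-u / 8) ≤ Real.exp 1 * Real.exp (-u / 8) := by gcongr
      _ = Real.exp (1 + -u / 8) := by rw [Real.exp_add]
      _ ≤ _ := Real.exp_le_exp.2 (by linarith)
  have hUD : P.real (U ∪ D) ≤ Real.exp (-(ε * n / (4096 * M))) := by
    have := measureReal_union_le (μ := P) U D
    linarith
  have hcompl : P.real (U ∪ D)ᶜ = 1 - P.real (U ∪ D) := by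
    rw [measureReal_compl (hUm.union hDm)]; simp
  calc _ ≤ P.real (U ∪ D)ᶜ := by rw [hcompl]; linarith
    _ ≤ _ := by
      refine measureReal_mono ?_ (measure_ne_top _ _)
      intro ω hω
      simp only [Set.compl_union, Set.mem_inter_iff, Set.mem_compl_iff, hU, hD, Set.mem_ofPred_eq,
        not_le] at hω
      obtain ⟨hω1, hω2⟩ := hω
      have hbd : ∀ q : ℚ, (if 0 < (q : ℝ) ∧ θ ≤ ∑ i, min (Z * rnd μ ν (ω i) / q) M
          then (q : ℝ) else 0) ≤ (1 + ε) * Z := by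
        intro q
        split_ifs with hq
        · by_contra! hlt
          have : ∑ i, min (Z * rnd μ ν (ω i) / q) M ≤ ∑ i, min (rnd μ ν (ω i) / (1 + ε)) M := by
            refine Finset.sum_le_sum fun i _ => min_le_min_right _ ?_
            rw [div_le_div_iff₀ hq.1 (by linarith)]
            have := mul_le_mul_of_nonneg_left hlt.le (rnd_nonneg μ ν (ω i))
            linarith
          linarith [hq.2]
        · positivity
      refine ⟨?_, ciSup_le hbd⟩
      have hZle : Z ≤ ⨆ q : ℚ, if 0 < (q : ℝ) ∧ θ ≤ ∑ i, min (Z * rnd μ ν (ω i) / q) M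
          then (q : ℝ) else 0 := by
        refine le_of_forall_lt fun c hc => ?_
        obtain ⟨q, hq1, hq2⟩ := exists_rat_btwn (max_lt hc hZ)
        have hq0 : (0:ℝ) < q := (le_max_right _ _).trans_lt hq1
        refine ((le_max_left _ _).trans_lt hq1).trans_le ?_
        refine le_ciSup_of_le ⟨_, Set.forall_mem_range.2 hbd⟩ q ?_
        rw [if_pos]
        refine ⟨hq0, hω2.le.trans ?_⟩
        refine Finset.sum_le_sum fun i _ => min_le_min_right _ ?_
        rw [le_div_iff₀ hq0, mul_comm]
        exact mul_le_mul_of_nonneg_right hq2.le (rnd_nonneg _ _ _)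
      have : 0 < ε * Z := by positivity
      simp only
      linarith

theorem caseB (h : ν ≪ μ) {ε M : ℝ} (hε : 0 < ε) (hε1 : ε < 1) (hM : 0 < M)
    (hI : ICov μ ν M ≤ ε * M / 4096) (n : ℕ) (hn : 16 * M ≤ n) (hn2 : ε * n ≤ 16 * M) :
    ∃ Zhat : (Fin n → ℝ) → ℝ, Measurable Zhat ∧ ∀ Z : ℝ, 0 < Z →
      ε * n / (4096 * M) ≤ (Measure.pi fun _ : Fin n => μ).real
        {ω | (1 - ε) * Z ≤ Zhat (fun i => Z * rnd μ ν (ω i)) ∧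
             Zhat (fun i => Z * rnd μ ν (ω i)) ≤ (1 + ε) * Z} := by
  have hr := measurable_rnd μ ν
  have hIM : ICov μ ν M / M ≤ ε / 4096 := by
    rw [div_le_iff₀ hM]; linarith
  have hn0 : (0:ℝ) < n := by linarith
  set P := (Measure.pi fun _ : Fin n => μ) with hP
  set U : Set (Fin n → X) := {ω | n + 4 * M ≤ ∑ i, min (rnd μ ν (ω i)) M} with hU
  set D : Set (Fin n → X) := {ω | ∑ i, min (rnd μ ν (ω i)) M ≤ n - 4 * M} with hD
  set T : Set (Fin n → X) := ⋃ i ∈ (Finset.univ : Finset (Fin n)), {ω | M ≤ rnd μ ν (ω i)} with hT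
  have hUm : MeasurableSet U := measurableSet_le measurable_const (by fun_prop)
  have hDm : MeasurableSet D := measurableSet_le (by fun_prop) measurable_const
  have hTm : MeasurableSet T := Finset.measurableSet_biUnion _ fun i _ =>
    measurableSet_le measurable_const (by fun_prop)
  have hPU : P.real U ≤ 1 / 4 := by
    have := upper h hM n (fun x => min (rnd μ ν x) M) (by fun_prop)
      (fun x => le_min (rnd_nonneg _ _ _) hM.le)
      (fun x => le_rfl) 1 (n + 4 * M) (by
        rw [← integral_rnd h]
        refine integral_mono_of_nonneg (ae_of_all _ fun x =>
          le_min (rnd_nonneg _ _ _) hM.le)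
          integrable_rnd (ae_of_all _ fun x => min_le_left _ _))
    refine this.trans ((Real.exp_le_exp.2 ?_).trans exp_neg_two)
    have e2 : n * (1 + ICov μ ν M / M) ≤ n * (1 + ε / 4096) := by gcongr
    rw [div_le_iff₀ hM]
    linarith
  have hPD : P.real D ≤ 1 / 4 := by
    refine (lower h hM n (n - 4 * M)).trans ((Real.exp_le_exp.2 ?_).trans exp_neg_two)
    have e2 : n * (1 - 2 * (ε / 4096)) ≤ n * (1 - 2 * (ICov μ ν M / M)) := by gcongr
    rw [div_le_iff₀ hM]
    linarith
  have hPT : P.real T ≤ 1 / 256 := by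
    have e1 := measureReal_biUnion_finset_le (μ := P) Finset.univ
      (fun i : Fin n => {ω : Fin n → X | M ≤ rnd μ ν (ω i)})
    have hm : MeasurableSet {x | M ≤ rnd μ ν x} := measurableSet_le measurable_const hr
    have e2 : ∀ i : Fin n, P.real {ω : Fin n → X | M ≤ rnd μ ν (ω i)} =
        μ.real {x | M ≤ rnd μ ν x} := fun i =>
      (measurePreserving_eval (fun _ : Fin n => μ) i).measureReal_preimage hm.nullMeasurableSet
    simp only [e2, Finset.sum_const, Finset.card_univ, Fintype.card_fin, nsmul_eq_mul] at e1
    have e3 := nu_ge h _ hm M (fun x hx => hx)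
    have e4 := tail (μ := μ) (ν := ν) hM le_rfl
    have e5 : ν.real {x | M ≤ rnd μ ν x} ≤ ε / 4096 := by
      by_contra! hlt
      have := mul_lt_mul_of_pos_left hlt hM
      linarith
    have e6 : n * (M * μ.real {x | M ≤ rnd μ ν x}) ≤ n * (ε / 4096) := by
      gcongr; linarith
    refine e1.trans ?_
    by_contra! hlt
    have := mul_lt_mul_of_pos_left hlt hM
    linarith
  have hbad : P.real (U ∪ D ∪ T) ≤ 3 / 4 := by
    have := measureReal_union_le (μ := P) U D
    have := measureReal_union_le (μ := P) (U ∪ D) T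
    linarith
  have hcompl : P.real (U ∪ D ∪ T)ᶜ = 1 - P.real (U ∪ D ∪ T) := by
    rw [measureReal_compl ((hUm.union hDm).union hTm)]; simp
  have hgood : 1 / 4 ≤ P.real {ω | n - 4 * M ≤ ∑ i, rnd μ ν (ω i) ∧
      ∑ i, rnd μ ν (ω i) ≤ n + 4 * M} := by
    calc 1 / 4 ≤ P.real (U ∪ D ∪ T)ᶜ := by rw [hcompl]; linarith
      _ ≤ _ := by
        refine measureReal_mono ?_ (measure_ne_top _ _)
        intro ω hω
        simp only [Set.compl_union, Set.mem_inter_iff, Set.mem_compl_iff, hU, hD, hT,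
          Set.mem_ofPred_eq, not_le, Set.mem_iUnion, Finset.mem_univ, exists_prop, true_and,
          not_exists] at hω
        obtain ⟨⟨h1, h2⟩, h3⟩ := hω
        have : ∑ i, min (rnd μ ν (ω i)) M = ∑ i, rnd μ ν (ω i) :=
          Finset.sum_congr rfl fun i _ => min_eq_left (h3 i).le
        rw [this] at h1 h2
        exact ⟨h2.le, h1.le⟩
  obtain ⟨s, hs, hs2⟩ := window P (fun ω => ∑ i, rnd μ ν (ω i)) (a := n - 4 * M) (b := n + 4 * M)
    (q := ε * n / (4096 * M)) (by linarith) (by linarith) hε (by positivity) hgood (by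
      have e1 : (n + 4 * M - (n - 4 * M)) / (ε * (n - 4 * M)) ≤ 16 * M / (ε * n) := by
        rw [div_le_div_iff₀ (mul_pos hε (by linarith)) (by positivity)]
        have : 0 ≤ ε * M * (n - 8 * M) := mul_nonneg (by positivity) (by linarith)
        linarith
      calc _ ≤ ε * n / (4096 * M) * (16 * M / (ε * n) + 1) := by gcongr
        _ = 16 / 4096 + (ε * n) / (4096 * M) := by field_simp
        _ ≤ 16 / 4096 + 16 / 4096 := by
          have : (ε * n) / (4096 * M) ≤ 16 / 4096 := by
            rw [div_le_div_iff₀ (by positivity) (by norm_num)]; linarith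
          linarith
        _ ≤ 1 / 4 := by norm_num)
  exact of_sum hε hs hs2

end

section
variable {X : Type} [MeasurableSpace X] {μ ν : Measure X}
    [IsProbabilityMeasure μ] [IsProbabilityMeasure ν]

theorem caseC1 (h : ν ≪ μ) {ε M : ℝ} (hε : 0 < ε) (hε1 : ε < 1) (hM : 0 < M)
    (n : ℕ) (hn0 : (0:ℝ) < n) (hn : (n:ℝ) ≤ 16 * M)
    (hν : 1 / 4 ≤ ν.real {x | rnd μ ν x < (n:ℝ) / 64}) :
    ∃ Zhat : (Fin n → ℝ) → ℝ, Measurable Zhat ∧ ∀ Z : ℝ, 0 < Z →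
      ε * n / (4096 * M) ≤ (Measure.pi fun _ : Fin n => μ).real
        {ω | (1 - ε) * Z ≤ Zhat (fun i => Z * rnd μ ν (ω i)) ∧
             Zhat (fun i => Z * rnd μ ν (ω i)) ≤ (1 + ε) * Z} := by
  have hr := measurable_rnd μ ν
  set P := (Measure.pi fun _ : Fin n => μ) with hP
  set A : Set X := {x | rnd μ ν x < (n:ℝ) / 64} with hA
  have hAm : MeasurableSet A := measurableSet_lt hr measurable_const
  set f : X → ℝ := A.indicator (rnd μ ν) with hf
  have hfm : Measurable f := hr.indicator hAm
  have hf0 : ∀ x, 0 ≤ f x := fun x => Set.indicator_nonneg (fun _ _ => rnd_nonneg _ _ _) x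
  have hfr : ∀ x, f x ≤ rnd μ ν x := fun x =>
    Set.indicator_le_self' (fun _ _ => rnd_nonneg _ _ _) x
  have hfb : ∀ x, f x ≤ n / 64 := fun x => by
    rw [hf]
    by_cases hx : x ∈ A
    · rw [Set.indicator_of_mem hx]; exact le_of_lt hx
    · rw [Set.indicator_of_notMem hx]; positivity
  have hfi : ∫ x, f x ∂μ = ν.real A := by
    rw [hf, integral_indicator hAm, setIntegral_rnd h]
  have hfint : Integrable f μ := integrable_rnd.indicator hAm
  have hg1 : ∀ x, 0 ≤ 32 / n * f x ∧ 32 / n * f x ≤ 1 / 2 := fun x => by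
    refine ⟨mul_nonneg (by positivity) (hf0 x), ?_⟩
    calc 32 / n * f x ≤ 32 / n * (n / 64) := by gcongr; exact hfb x
      _ = 1 / 2 := by field_simp; norm_num
  have hc := chernoff μ n (fun x => -(32 / n * f x)) (by fun_prop) (fun x => by
    rw [abs_neg, abs_of_nonneg (hg1 x).1]; linarith [(hg1 x).2]) (-(4 / n)) (-2) (by
      have e1 : ∫ x, (-(32 / n * f x)) ^ 2 ∂μ ≤ ∫ x, 16 / n * f x ∂μ := by
        refine integral_mono_of_nonneg (ae_of_all _ fun x => sq_nonneg _) (hfint.const_mul _)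
          (ae_of_all _ fun x => ?_)
        have e2 : (16:ℝ) / n * f x = 1 / 2 * (32 / n * f x) := by ring
        simp only
        rw [e2, neg_sq, sq]
        exact mul_le_mul_of_nonneg_right (hg1 x).2 (hg1 x).1
      rw [integral_neg, integral_const_mul, hfi]
      rw [integral_const_mul, hfi] at e1
      have e3 : 16 / n * (1 / 4) ≤ 16 / n * ν.real A := by gcongr
      have e4 : (32:ℝ) / n * ν.real A = 2 * (16 / n * ν.real A) := by ring
      have e5 : (16:ℝ) / n * (1 / 4) = 4 / n := by ring
      linarith)
  set D : Set (Fin n → X) := {ω | -2 ≤ ∑ i, -(32 / n * f (ω i))} with hD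
  have hDm : MeasurableSet D := measurableSet_le measurable_const (by fun_prop)
  have hPD : P.real D ≤ 1 / 4 := by
    refine hc.trans (le_trans (le_of_eq ?_) exp_neg_two)
    congr 1
    field_simp; norm_num
  set U : Set (Fin n → X) := {ω | 4 * (n:ℝ) ≤ ∑ i, rnd μ ν (ω i)} with hU
  have hUm : MeasurableSet U := measurableSet_le measurable_const (by fun_prop)
  have hPU : P.real U ≤ 1 / 4 := by
    have hint : ∀ i : Fin n, Integrable (fun ω : Fin n → X => rnd μ ν (ω i)) P := fun i =>
      integrable_comp_eval (μ := fun _ : Fin n => μ) integrable_rnd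
    have e1 := mul_meas_ge_le_integral_of_nonneg (μ := P) (f := fun ω => ∑ i, rnd μ ν (ω i))
      (ae_of_all _ fun ω => Finset.sum_nonneg fun i _ => rnd_nonneg _ _ _)
      (integrable_finset_sum _ fun i _ => hint i) (4 * n)
    have e2 : ∀ i : Fin n, ∫ ω, rnd μ ν (ω i) ∂P = 1 := fun i => by
      rw [hP, integral_comp_eval (μ := fun _ : Fin n => μ) (f := rnd μ ν)
        hr.aestronglyMeasurable, integral_rnd h]
    rw [integral_finset_sum _ fun i _ => hint i] at e1
    simp only [e2, Finset.sum_const, Finset.card_univ, Fintype.card_fin, nsmul_eq_mul] at e1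
    by_contra! hlt
    have := mul_lt_mul_of_pos_left hlt hn0
    linarith
  have hbad : P.real (U ∪ D) ≤ 1 / 2 := by
    have := measureReal_union_le (μ := P) U D
    linarith
  have hcompl : P.real (U ∪ D)ᶜ = 1 - P.real (U ∪ D) := by
    rw [measureReal_compl (hUm.union hDm)]; simp
  have hgood : 1 / 2 ≤ P.real {ω | (n:ℝ) / 16 ≤ ∑ i, rnd μ ν (ω i) ∧
      ∑ i, rnd μ ν (ω i) ≤ 4 * n} := by
    calc 1 / 2 ≤ P.real (U ∪ D)ᶜ := by rw [hcompl]; linarith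
      _ ≤ _ := by
        refine measureReal_mono ?_ (measure_ne_top _ _)
        intro ω hω
        simp only [Set.compl_union, Set.mem_inter_iff, Set.mem_compl_iff, hU, hD,
          Set.mem_ofPred_eq, not_le, Finset.sum_neg_distrib, ← Finset.mul_sum] at hω
        obtain ⟨h1, h2⟩ := hω
        refine ⟨?_, h1.le⟩
        have h3 : ∑ i, f (ω i) ≤ ∑ i, rnd μ ν (ω i) := Finset.sum_le_sum fun i _ => hfr _
        refine le_trans ?_ h3
        by_contra! hlt
        have e1 : 32 / n * ∑ i, f (ω i) ≤ 32 / n * (n / 16) := by gcongr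
        have e2 : 32 / (n:ℝ) * (n / 16) = 2 := by field_simp; norm_num
        linarith
  obtain ⟨s, hs, hs2⟩ := window P (fun ω => ∑ i, rnd μ ν (ω i)) (a := (n:ℝ) / 16) (b := 4 * n)
    (q := ε * n / (4096 * M)) (by positivity) (by linarith) hε (by positivity) hgood (by
      have e1 : (4 * (n:ℝ) - n / 16) / (ε * (n / 16)) = 63 / ε := by
        field_simp; norm_num
      rw [e1]
      calc _ = (n / M) * ((63 + ε) / 4096) := by field_simp
        _ ≤ 16 * (64 / 4096) := by
          gcongr
          · rw [div_le_iff₀ hM]; exact hn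
          · linarith
        _ ≤ 1 / 2 := by norm_num)
  exact of_sum hε hs hs2

theorem caseC2 (h : ν ≪ μ) {ε M : ℝ} (hε : 0 < ε) (hε1 : ε < 1) (hM : 0 < M)
    (n : ℕ) (hn0 : 0 < n)
    (hν : 1 / 4 ≤ ν.real {x | (n:ℝ) / 64 ≤ rnd μ ν x ∧ rnd μ ν x < ε * M / 2048}) :
    ∃ Zhat : (Fin n → ℝ) → ℝ, Measurable Zhat ∧ ∀ Z : ℝ, 0 < Z →
      ε * n / (4096 * M) ≤ (Measure.pi fun _ : Fin n => μ).real
        {ω | (1 - ε) * Z ≤ Zhat (fun i => Z * rnd μ ν (ω i)) ∧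
             Zhat (fun i => Z * rnd μ ν (ω i)) ≤ (1 + ε) * Z} := by
  classical
  have hr := measurable_rnd μ ν
  have hn0' : (0:ℝ) < n := by exact_mod_cast hn0
  obtain ⟨a, hLa, ha⟩ := geom_bins h (L := (n:ℝ) / 64) (K := ε * M / 2048) (by positivity)
    (by positivity) hε hε1 hν
  have ha0 : 0 < a := lt_of_lt_of_le (by positivity) hLa
  set m := n / 128 + 1 with hm
  have hmn : m ≤ n := by omega
  have hm1 : ((m:ℝ) - 1) ≤ n / 128 := by
    rw [hm]; push_cast
    have : ((n / 128 : ℕ) : ℝ) ≤ (n:ℝ) / (128 : ℕ) := Nat.cast_div_le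
    push_cast at this
    linarith
  have hm2 : (n:ℝ) / 128 ≤ m := by
    rw [div_le_iff₀ (by norm_num)]
    have : n ≤ m * 128 := by omega
    exact_mod_cast this
  set P := (Measure.pi fun _ : Fin n => μ) with hP
  haveI : Nonempty (Fin m) := ⟨⟨0, by omega⟩⟩
  -- law of the maximum of the first m samples
  have hlaw : ∀ b : ℝ, P.real {ω | ∀ i : Fin m, rnd μ ν (ω (Fin.castLE hmn i)) < b} =
      μ.real {x | rnd μ ν x < b} ^ m := by
    intro b
    have e1 : {ω : Fin n → X | ∀ i : Fin m, rnd μ ν (ω (Fin.castLE hmn i)) < b} =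
        Set.univ.pi (fun j : Fin n => if j.val < m then {x | rnd μ ν x < b} else Set.univ) := by
      ext ω
      simp only [Set.mem_ofPred_eq, Set.mem_univ_pi]
      constructor
      · intro hω j
        split_ifs with hj
        · exact hω ⟨j, hj⟩
        · trivial
      · intro hω i
        have := hω (Fin.castLE hmn i)
        rw [if_pos (by simp)] at this
        exact this
    rw [e1, hP, Measure.real, Measure.pi_pi, ENNReal.toReal_prod]
    have e2 : ∀ j : Fin n, (μ (if j.val < m then {x | rnd μ ν x < b} else Set.univ)).toReal =
        if j.val < m then μ.real {x | rnd μ ν x < b} else 1 := by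
      intro j
      split_ifs
      · rfl
      · simp
    simp only [e2]
    rw [Finset.prod_ite]
    simp only [Finset.prod_const, one_pow, mul_one]
    congr 1
    rw [Fin.card_filter_val_lt]
    exact min_eq_right hmn
  set y := μ.real {x | rnd μ ν x < a} with hy
  set x := μ.real {x | rnd μ ν x < a * (1 + ε)} with hx
  set p := μ.real {x | a ≤ rnd μ ν x ∧ rnd μ ν x < a * (1 + ε)} with hp
  have hxy : x = y + p := by
    rw [hx, hy, hp, ← measureReal_union]
    · congr 1
      ext z
      simp only [Set.mem_ofPred_eq, Set.mem_union]
      constructor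
      · intro hz
        rcases lt_or_ge (rnd μ ν z) a with h | h
        · exact Or.inl h
        · exact Or.inr ⟨h, hz⟩
      · rintro (hz | hz)
        · nlinarith
        · exact hz.2
    · rw [Set.disjoint_left]
      intro z hz hz2
      exact absurd hz2.1 (not_le.2 hz)
    · exact (measurableSet_le measurable_const hr).inter (measurableSet_lt hr measurable_const)
  have hy0 : 0 ≤ y := measureReal_nonneg
  have hp0 : 0 ≤ p := measureReal_nonneg
  have hy1 : 1 - 64 / n ≤ y := by
    have hms : MeasurableSet {x | a ≤ rnd μ ν x} := measurableSet_le measurable_const hr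
    have e1 := nu_ge h _ hms a (fun x hx => hx)
    have e2 : ν.real {x | a ≤ rnd μ ν x} ≤ 1 := measureReal_le_one
    have e3 : y = 1 - μ.real {x | a ≤ rnd μ ν x} := by
      have : {x | rnd μ ν x < a} = {x | a ≤ rnd μ ν x}ᶜ := by ext z; simp
      rw [hy, this, measureReal_compl hms]; simp
    have e4 : (n:ℝ) / 64 * μ.real {x | a ≤ rnd μ ν x} ≤ 1 := by
      have : (n:ℝ) / 64 * μ.real {x | a ≤ rnd μ ν x} ≤ a * μ.real {x | a ≤ rnd μ ν x} := by
        gcongr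
      linarith
    have e5 : μ.real {x | a ≤ rnd μ ν x} ≤ 64 / n := by
      rw [le_div_iff₀ hn0']; linarith
    linarith
  have hy1' : y ≤ 1 := measureReal_le_one
  have hypow : 1 / 2 ≤ y ^ (m - 1) := by
    have e1 := one_add_mul_le_pow (a := y - 1) (by linarith) (m - 1)
    have e2 : ((m - 1 : ℕ) : ℝ) = (m:ℝ) - 1 := by
      rw [Nat.cast_sub (by omega)]; simp
    rw [e2] at e1
    have e3 : ((m:ℝ) - 1) * (1 - y) ≤ (n / 128) * (64 / n) := by
      gcongr
      linarith
    have e4 : ((n:ℝ) / 128) * (64 / n) = 1 / 2 := by field_simp; norm_num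
    have e5 : 1 + (y - 1) = y := by ring
    rw [e5] at e1
    linarith
  have hdiff : m * y ^ (m - 1) * p ≤ x ^ m - y ^ m := by
    have key : ∀ k : ℕ, (k + 1) * y ^ k * p ≤ (y + p) ^ (k + 1) - y ^ (k + 1) := by
      intro k
      induction k with
      | zero => simp
      | succ k ih =>
        have e1 : y ^ (k + 1) ≤ (y + p) ^ (k + 1) := by gcongr; linarith
        have e2 : 0 ≤ p * ((y + p) ^ (k + 1) - y ^ (k + 1)) := mul_nonneg hp0 (by linarith)
        have e3 := mul_le_mul_of_nonneg_left ih hy0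
        have e4 : (y + p) ^ (k + 1 + 1) = (y + p) * (y + p) ^ (k + 1) := by ring
        have e5 : y ^ (k + 1 + 1) = y * y ^ (k + 1) := by ring
        have e6 : y * ((k + 1) * y ^ k * p) = (k + 1) * y ^ (k + 1) * p := by ring
        rw [e4, e5]
        rw [e6] at e3
        push_cast
        linarith
    have := key (m - 1)
    rw [hxy]
    have e2 : ((m - 1 : ℕ) : ℝ) + 1 = (m:ℝ) := by
      rw [Nat.cast_sub (by omega)]; simp
    rw [e2, Nat.sub_add_cancel (by omega)] at this
    exact this
  refine ⟨fun v => (⨆ i : Fin m, v (Fin.castLE hmn i)) / a, ?_, ?_⟩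
  · have hms : Measurable fun v : Fin n → ℝ => ⨆ i : Fin m, v (Fin.castLE hmn i) :=
      Measurable.iSup fun i => measurable_pi_apply _
    exact hms.div_const a
  intro Z hZ
  set V : ℝ → Set (Fin n → X) :=
    fun b => {ω | ∀ i : Fin m, rnd μ ν (ω (Fin.castLE hmn i)) < b} with hV
  have hVm : ∀ b, MeasurableSet (V b) := fun b => by
    have : V b = ⋂ i : Fin m, {ω | rnd μ ν (ω (Fin.castLE hmn i)) < b} := by
      ext ω; simp [hV]
    rw [this]
    exact MeasurableSet.iInter fun i => measurableSet_lt (by fun_prop) measurable_const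
  have hsub : V a ⊆ V (a * (1 + ε)) := fun ω hω i => (hω i).trans (by nlinarith)
  have hPV : P.real (V (a * (1 + ε)) \ V a) = x ^ m - y ^ m := by
    rw [measureReal_sdiff hsub (hVm a), hlaw, hlaw]
  calc ε * n / (4096 * M) ≤ m * y ^ (m - 1) * p := by
        have e1 : (n:ℝ) / 128 * (1 / 2) * (ε / (32 * (ε * M / 2048))) ≤ m * y ^ (m - 1) * p := by
          gcongr
        refine le_trans ?_ e1
        have e2 : (n:ℝ) / 128 * (1 / 2) * (ε / (32 * (ε * M / 2048))) = n / (4 * M) := by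
          field_simp; norm_num
        rw [e2, div_le_div_iff₀ (by positivity) (by positivity)]
        have : ε * (n * (4 * M)) ≤ 1 * (n * (4 * M)) := by gcongr
        have : 0 ≤ n * M := by positivity
        linarith
    _ ≤ P.real (V (a * (1 + ε)) \ V a) := by rw [hPV]; exact hdiff
    _ ≤ _ := by
      refine measureReal_mono ?_ (measure_ne_top _ _)
      rintro ω ⟨h1, h2⟩
      simp only [hV, Set.mem_ofPred_eq, not_forall, not_lt] at h1 h2
      obtain ⟨i, hi⟩ := h2
      simp only [Set.mem_ofPred_eq]
      rw [le_div_iff₀ ha0, div_le_iff₀ ha0]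
      have hb : ∀ i : Fin m, Z * rnd μ ν (ω (Fin.castLE hmn i)) ≤ (1 + ε) * Z * a := fun i => by
        have := mul_le_mul_of_nonneg_left (h1 i).le hZ.le
        linarith
      refine ⟨?_, ciSup_le hb⟩
      refine le_ciSup_of_le ⟨_, Set.forall_mem_range.2 hb⟩ i ?_
      have := mul_le_mul_of_nonneg_left hi hZ.le
      have : 0 < ε * Z * a := by positivity
      linarith

theorem caseC (h : ν ≪ μ) {ε M : ℝ} (hε : 0 < ε) (hε1 : ε < 1) (hM : 0 < M)
    (hI : ICov μ ν M ≤ ε * M / 4096) (n : ℕ) (hn0 : 0 < n) (hn : (n:ℝ) ≤ 16 * M) :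
    ∃ Zhat : (Fin n → ℝ) → ℝ, Measurable Zhat ∧ ∀ Z : ℝ, 0 < Z →
      ε * n / (4096 * M) ≤ (Measure.pi fun _ : Fin n => μ).real
        {ω | (1 - ε) * Z ≤ Zhat (fun i => Z * rnd μ ν (ω i)) ∧
             Zhat (fun i => Z * rnd μ ν (ω i)) ≤ (1 + ε) * Z} := by
  have hr := measurable_rnd μ ν
  by_cases h1 : 1 / 4 ≤ ν.real {x | rnd μ ν x < (n:ℝ) / 64}
  · exact caseC1 h hε hε1 hM n (by exact_mod_cast hn0) hn h1
  refine caseC2 h hε hε1 hM n hn0 ?_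
  push Not at h1
  set K := ε * M / 2048 with hK
  have hK0 : 0 < K := by positivity
  have hKM : K ≤ M := by rw [hK]; nlinarith
  have e1 := tail (μ := μ) (ν := ν) hM hKM
  have e2 : ν.real {x | K ≤ rnd μ ν x} ≤ 1 / 2 := by
    by_contra! hlt
    have := mul_lt_mul_of_pos_left hlt hK0
    linarith
  have e3 : (1:ℝ) ≤ ν.real {x | rnd μ ν x < (n:ℝ) / 64} + ν.real {x | K ≤ rnd μ ν x} +
      ν.real {x | (n:ℝ) / 64 ≤ rnd μ ν x ∧ rnd μ ν x < K} := by
    have u1 := measureReal_union_le (μ := ν) {x | rnd μ ν x < (n:ℝ) / 64} {x | K ≤ rnd μ ν x}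
    have u2 := measureReal_union_le (μ := ν) ({x | rnd μ ν x < (n:ℝ) / 64} ∪ {x | K ≤ rnd μ ν x})
      {x | (n:ℝ) / 64 ≤ rnd μ ν x ∧ rnd μ ν x < K}
    have u3 : ({x | rnd μ ν x < (n:ℝ) / 64} ∪ {x | K ≤ rnd μ ν x}) ∪
      {x | (n:ℝ) / 64 ≤ rnd μ ν x ∧ rnd μ ν x < K} = Set.univ := by
      ext x
      simp only [Set.mem_union, Set.mem_ofPred_eq, Set.mem_univ, iff_true]
      rcases lt_or_ge (rnd μ ν x) ((n:ℝ) / 64) with h | h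
      · exact Or.inl (Or.inl h)
      · rcases lt_or_ge (rnd μ ν x) K with h' | h'
        · exact Or.inr ⟨h, h'⟩
        · exact Or.inl (Or.inr h')
    rw [u3] at u2
    simp only [probReal_univ] at u2
    linarith
  linarith

end

/-- There is a universal constant `C ≥ 1` such that for probability measures
`ν ≪ μ`, `0 < ε < 1`, `0 < δ < 1`, and `M > 0` with `ICov_M(ν‖μ) ≤ ε·M/C`, for every
`n ≥ C·M·log(1/δ)/ε` there is a measurable estimator `Ẑ : ℝⁿ → ℝ` such that for every `Z > 0`,
with probability at least `1 - δ` under `μ^{⊗n}` (coordinates `X₁, …, X_n`),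
`(1−ε)·Z ≤ Ẑ(Z·r(X₁), …, Z·r(X_n)) ≤ (1+ε)·Z`. -/
theorem stmt0 :
    ∃ C : ℝ, 1 ≤ C ∧
      ∀ (X : Type) [MeasurableSpace X] (μ ν : Measure X)
        [IsProbabilityMeasure μ] [IsProbabilityMeasure ν],
        ν ≪ μ →
        ∀ ε δ M : ℝ, 0 < ε → ε < 1 → 0 < δ → δ < 1 → 0 < M →
          ICov μ ν M ≤ ε * M / C →
          ∀ n : ℕ, C * M * Real.log (1 / δ) / ε ≤ (n : ℝ) →
            ∃ Zhat : (Fin n → ℝ) → ℝ, Measurable Zhat ∧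
              ∀ Z : ℝ, 0 < Z →
                ENNReal.ofReal (1 - δ) ≤
                  (Measure.pi fun _ : Fin n => μ)
                    {ω | (1 - ε) * Z ≤ Zhat (fun i => Z * rnd μ ν (ω i)) ∧
                         Zhat (fun i => Z * rnd μ ν (ω i)) ≤ (1 + ε) * Z} := by
  refine ⟨4096, by norm_num, ?_⟩
  intro X _ μ ν _ _ h ε δ M hε hε1 hδ hδ1 hM hI n hn
  have hlog : 0 < Real.log (1 / δ) := Real.log_pos (by rw [lt_div_iff₀ hδ]; linarith)
  have hn0' : (0:ℝ) < n := lt_of_lt_of_le (by positivity) hn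
  have hn0 : 0 < n := by exact_mod_cast hn0'
  have hexp : 1 - δ ≤ 1 - Real.exp (-(ε * n / (4096 * M))) := by
    have e1 : Real.log (1 / δ) ≤ ε * n / (4096 * M) := by
      rw [div_le_iff₀ hε] at hn
      rw [le_div_iff₀ (by positivity)]
      linarith
    have e2 : Real.exp (-(ε * n / (4096 * M))) ≤ δ := by
      rw [← Real.exp_log hδ, Real.exp_le_exp]
      rw [one_div, Real.log_inv] at e1
      linarith
    linarith
  have hlin : 1 - δ ≤ ε * n / (4096 * M) := by
    have := Real.add_one_le_exp (-(ε * n / (4096 * M)))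
    linarith
  have fin : ∀ q : ℝ, 1 - δ ≤ q → (∃ Zhat : (Fin n → ℝ) → ℝ, Measurable Zhat ∧ ∀ Z : ℝ, 0 < Z →
      q ≤ (Measure.pi fun _ : Fin n => μ).real
        {ω | (1 - ε) * Z ≤ Zhat (fun i => Z * rnd μ ν (ω i)) ∧
             Zhat (fun i => Z * rnd μ ν (ω i)) ≤ (1 + ε) * Z}) →
      ∃ Zhat : (Fin n → ℝ) → ℝ, Measurable Zhat ∧
              ∀ Z : ℝ, 0 < Z →
                ENNReal.ofReal (1 - δ) ≤
                  (Measure.pi fun _ : Fin n => μ)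
                    {ω | (1 - ε) * Z ≤ Zhat (fun i => Z * rnd μ ν (ω i)) ∧
                         Zhat (fun i => Z * rnd μ ν (ω i)) ≤ (1 + ε) * Z} := by
    rintro q hq ⟨Zhat, hZm, hZ⟩
    refine ⟨Zhat, hZm, fun Z hZ0 => ?_⟩
    exact ENNReal.ofReal_le_of_le_toReal (hq.trans (hZ Z hZ0))
  rcases le_total (16 * M) (ε * n) with h1 | h1
  · exact fin _ hexp (caseA h hε hε1 hM hI n h1)
  rcases le_total (16 * M) n with h2 | h2
  · exact fin _ hlin (caseB h hε hε1 hM hI n h2 h1)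
  · exact fin _ hlin (caseC h hε hε1 hM hI n hn0 h2)
end

section
/- Let f : [0,∞) → [0,∞) be convex with f(1) = 0 and f′(1) = 0, let C > 2 and ε ∈ (0, 1/4), and suppose γ := γ_f(C/(2ε)) is finite and satisfies γ ≥ 2. Let μ be a probability measure on X admitting a measurable set A with μ(A) = p, where p = 2ε/γ, and define the probability measure ν by dν/dμ = 1−ε on the complement of A and dν/dμ = 1 + ε·(1/p − 1) on A. Then D_f(ν‖μ) ≤ C + f(1−ε); moreover, with λ₀ ≡ 1 (normalizing constant Z₀ = 1) and λ₁ = Z₁·(dν/dμ) where Z₁ = 1/(1−ε), for every natural number n ≤ log(3/2)/(2p) = γ·log(3/2)/(4ε) there is no measurable function φ : ℝⁿ → ℝ satisfying both μ^{⊗n}( φ(λ₀(X₁), …, λ₀(X_n)) ∈ [1 − ε/3, 1 + ε/3] ) ≥ 2/3 and μ^{⊗n}( φ(λ₁(X₁), …, λ₁(X_n)) ∈ [(1 − ε/3)·Z₁, (1 + ε/3)·Z₁] ) ≥ 2/3. -/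
open MeasureTheory Real
open scoped ENNReal

/-- `γ_f(M) = inf {t ≥ 1 : f(t)/t ≥ M}`. -/
noncomputable def gammaf (f : ℝ → ℝ) (M : ℝ) : ℝ :=
  sInf {t : ℝ | 1 ≤ t ∧ M ≤ f t / t}

open Classical in
/-- Let `f` be convex and nonnegative on `[0,∞)` with `f(1) = 0`, `f'(1) = 0`,
let `C > 2`, `ε ∈ (0, 1/4)`, and suppose `γ := γ_f(C/(2ε))` is finite (the defining set is
nonempty) and `γ ≥ 2`.  Let `μ` be a probability measure admitting a measurable set `A` with
`μ(A) = p` where `p = 2ε/γ`, and define `ν` by `dν/dμ = 1−ε` off `A` and `1 + ε(1/p − 1)`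
on `A`.  Then `D_f(ν‖μ) ≤ C + f(1−ε)`; moreover, with `λ₀ ≡ 1` (`Z₀ = 1`) and
`λ₁ = Z₁·(dν/dμ)` with `Z₁ = 1/(1−ε)`, for every `n ≤ log(3/2)/(2p)` there is no measurable
`φ : ℝⁿ → ℝ` succeeding with probability at least `2/3` in both scenarios. -/
theorem stmt4 (f : ℝ → ℝ) (hconv : ConvexOn ℝ (Set.Ici 0) f)
    (hnonneg : ∀ t ∈ Set.Ici (0 : ℝ), 0 ≤ f t) (hf1 : f 1 = 0) (hf'1 : HasDerivAt f 0 1)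
    (C ε : ℝ) (hC : 2 < C) (hε : ε ∈ Set.Ioo (0 : ℝ) (1 / 4))
    (hfin : {t : ℝ | 1 ≤ t ∧ C / (2 * ε) ≤ f t / t}.Nonempty)
    (hγ2 : 2 ≤ gammaf f (C / (2 * ε)))
    (p : ℝ) (hp : p = 2 * ε / gammaf f (C / (2 * ε)))
    {X : Type*} [MeasurableSpace X] (μ : Measure X) [IsProbabilityMeasure μ]
    (A : Set X) (hA : MeasurableSet A) (hAp : μ A = ENNReal.ofReal p) :
    (∫ x, f (if x ∈ A then 1 + ε * (1 / p - 1) else 1 - ε) ∂μ) ≤ C + f (1 - ε) ∧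
    ∀ n : ℕ, (n : ℝ) ≤ Real.log (3 / 2) / (2 * p) →
      ¬ ∃ φ : (Fin n → ℝ) → ℝ, Measurable φ ∧
        (2 / 3 : ℝ≥0∞) ≤ (Measure.pi fun _ : Fin n => μ)
          {ω | 1 - ε / 3 ≤ φ (fun _ => (1 : ℝ)) ∧ φ (fun _ => (1 : ℝ)) ≤ 1 + ε / 3} ∧
        (2 / 3 : ℝ≥0∞) ≤ (Measure.pi fun _ : Fin n => μ)
          {ω | (1 - ε / 3) * (1 / (1 - ε)) ≤
                 φ (fun i => (1 / (1 - ε)) *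
                   (if ω i ∈ A then 1 + ε * (1 / p - 1) else 1 - ε)) ∧
               φ (fun i => (1 / (1 - ε)) *
                   (if ω i ∈ A then 1 + ε * (1 / p - 1) else 1 - ε)) ≤
                 (1 + ε / 3) * (1 / (1 - ε))} := by

  obtain ⟨hε0, hε1⟩ := hε
  set γ := gammaf f (C / (2 * ε)) with hγ
  have hγ0 : 0 < γ := by linarith
  have hp0 : 0 < p := by rw [hp]; positivity
  have hpg : p * γ = 2 * ε := by rw [hp]; field_simp
  have hp1 : p ≤ 1 := by nlinarith
  constructor
  · set t := 1 + ε * (1 / p - 1) with ht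
    have ht2 : t = 1 - ε + γ / 2 := by
      have : ε * (1 / p) = γ / 2 := by field_simp; linarith
      rw [ht, mul_sub, this]; ring
    have ht1 : 1 ≤ t ∨ t < 1 := le_or_gt _ _
    have htg : t < γ := by rw [ht2]; linarith
    have ht0 : 0 < t := by rw [ht2]; linarith
    have hft : p * f t ≤ C := by
      rcases ht1 with ht1 | ht1
      · have hn : t ∉ {t : ℝ | 1 ≤ t ∧ C / (2 * ε) ≤ f t / t} := by
          apply notMem_of_lt_csInf htg
          exact ⟨1, fun x hx => hx.1⟩
        have h1 : f t / t < C / (2 * ε) := by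
          by_contra h
          exact hn ⟨ht1, not_lt.mp h⟩
        rw [div_lt_div_iff₀ ht0 (by positivity), ← hpg] at h1
        have h2 : f t * p * γ ≤ C * γ := by nlinarith
        have := le_of_mul_le_mul_right h2 hγ0
        linarith
      · exfalso; rw [ht2] at ht1; linarith
    have hfun : (fun x => f (if x ∈ A then t else 1 - ε)) =
        fun x => A.indicator (fun _ => f t) x + Aᶜ.indicator (fun _ => f (1 - ε)) x := by
      funext x
      by_cases hx : x ∈ A <;> simp [hx]
    have hr : μ.real A = p := by
      rw [measureReal_def, hAp, ENNReal.toReal_ofReal hp0.le]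
    rw [hfun, integral_add ((integrable_const _).indicator hA)
      ((integrable_const _).indicator hA.compl), integral_indicator_const _ hA,
      integral_indicator_const _ hA.compl, probReal_compl_eq_one_sub hA, hr, smul_eq_mul,
      smul_eq_mul]
    have := hnonneg (1 - ε) (by simp only [Set.mem_Ici]; linarith)
    nlinarith
  · rintro n hn ⟨φ, -, h0, h1⟩
    have hφ : φ (fun _ => (1 : ℝ)) ≤ 1 + ε / 3 := by
      by_contra h
      simp [h] at h0
    have hsub : {ω : Fin n → X | (1 - ε / 3) * (1 / (1 - ε)) ≤
                 φ (fun i => (1 / (1 - ε)) *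
                   (if ω i ∈ A then 1 + ε * (1 / p - 1) else 1 - ε)) ∧
               φ (fun i => (1 / (1 - ε)) *
                   (if ω i ∈ A then 1 + ε * (1 / p - 1) else 1 - ε)) ≤
                 (1 + ε / 3) * (1 / (1 - ε))} ⊆ ⋃ i : Fin n, (Function.eval i) ⁻¹' A := by
      rintro ω ⟨hω, -⟩
      by_contra hc
      simp only [Set.mem_iUnion, Set.mem_preimage, Function.eval, not_exists] at hc
      have he : (1 : ℝ) - ε ≠ 0 := by linarith
      simp only [hc, if_false, one_div_mul_cancel he] at hω
      have h3 := hω.trans hφ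
      rw [mul_one_div, div_le_iff₀ (by linarith)] at h3
      nlinarith
    have h2 := h1.trans ((measure_mono hsub).trans (measure_iUnion_le _))
    have h3 : ∀ i : Fin n, (Measure.pi fun _ : Fin n => μ) (Function.eval i ⁻¹' A)
        = ENNReal.ofReal p := fun i => by
      rw [(measurePreserving_eval (fun _ : Fin n => μ) i).measure_preimage hA.nullMeasurableSet,
        hAp]
    simp only [h3, tsum_fintype, Finset.sum_const, Finset.card_univ, Fintype.card_fin,
      nsmul_eq_mul] at h2
    have h4 : (2 / 3 : ℝ) ≤ n * p := by
      have := ENNReal.toReal_mono (by finiteness) h2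
      simpa [ENNReal.toReal_ofReal hp0.le] using this
    have h5 : Real.log (3 / 2) ≤ 3 / 2 - 1 := Real.log_le_sub_one_of_pos (by norm_num)
    rw [le_div_iff₀ (by positivity)] at hn
    linarith
end

section
/- Let f : [0,∞) → [0,∞) be convex with f(1) = 0 and f′(1) = 0, let C > 0 and ε ∈ (0, 1/4), and suppose γ := γ_f(C/(2ε)) is finite and satisfies γ ≥ 2. Then for every p with 2ε/γ ≤ p ≤ 1 it holds that p·f(1 − ε + ε/p) ≤ C; consequently (1−p)·f(1−ε) + p·f(1 + ε·(1/p − 1)) ≤ C + f(1−ε). -/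
open MeasureTheory Real

/-- Let `f` be convex and nonnegative on `[0,∞)` with `f(1) = 0` and
`f'(1) = 0`, let `C > 0`, `ε ∈ (0, 1/4)`, and suppose `γ := γ_f(C/(2ε))` is finite
(the defining set is nonempty) and `γ ≥ 2`.  Then for every `p` with `2ε/γ ≤ p ≤ 1`,
`p·f(1 − ε + ε/p) ≤ C`; consequently
`(1−p)·f(1−ε) + p·f(1 + ε·(1/p − 1)) ≤ C + f(1−ε)`. -/
theorem stmt5 (f : ℝ → ℝ) (hconv : ConvexOn ℝ (Set.Ici 0) f)
    (hnonneg : ∀ t ∈ Set.Ici (0 : ℝ), 0 ≤ f t) (hf1 : f 1 = 0) (hf'1 : HasDerivAt f 0 1)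
    (C ε : ℝ) (hC : 0 < C) (hε : ε ∈ Set.Ioo (0 : ℝ) (1 / 4))
    (hfin : {t : ℝ | 1 ≤ t ∧ C / (2 * ε) ≤ f t / t}.Nonempty)
    (hγ2 : 2 ≤ gammaf f (C / (2 * ε))) :
    ∀ p : ℝ, 2 * ε / gammaf f (C / (2 * ε)) ≤ p → p ≤ 1 →
      p * f (1 - ε + ε / p) ≤ C ∧
      (1 - p) * f (1 - ε) + p * f (1 + ε * (1 / p - 1)) ≤ C + f (1 - ε) := by
  obtain ⟨hε0, hε4⟩ := hε
  intro p hp hp1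
  set γ := gammaf f (C / (2 * ε)) with hγ
  have hγ0 : 0 < γ := by linarith
  have hp0 : 0 < p := lt_of_lt_of_le (by positivity) hp
  have hbelow : ∀ y : ℝ, 1 ≤ y → y < γ → 2 * ε * f y ≤ C * y := by
    intro y hy1 hyγ
    have hnot : y ∉ {t : ℝ | 1 ≤ t ∧ C / (2 * ε) ≤ f t / t} :=
      notMem_of_lt_csInf hyγ ⟨1, fun t ht => ht.1⟩
    have h2 : f y / y < C / (2 * ε) := by
      by_contra hcon
      exact hnot ⟨hy1, not_lt.mp hcon⟩
    rw [div_lt_div_iff₀ (by linarith) (by linarith)] at h2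
    linarith
  have hmain : p * f (1 - ε + ε / p) ≤ C := by
    rcases le_total (p * (1 - ε)) ε with h | h
    · have h1 : 1 ≤ 1 / p := by rw [le_div_iff₀ hp0]; linarith
      have hεp : ε ≤ ε / p := by rw [le_div_iff₀ hp0]; nlinarith
      have hup : ε / p ≤ γ / 2 := by
        rw [div_le_iff₀ hγ0] at hp
        rw [div_le_iff₀ hp0]; linarith
      have hb := hbelow (1 - ε + ε / p) (by linarith) (by linarith)
      have hpe : p * (ε / p) = ε := by field_simp
      have h3 := mul_le_mul_of_nonneg_left hb hp0.le
      have h4 : p * (C * (1 - ε + ε / p)) = C * (p * (1 - ε) + ε) := by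
        rw [← hpe]; field_simp
      have h5 : C * (p * (1 - ε) + ε) ≤ C * (2 * ε) :=
        mul_le_mul_of_nonneg_left (by linarith) hC.le
      have h6 : (2 * ε) * (p * f (1 - ε + ε / p)) ≤ (2 * ε) * C := by linarith
      exact le_of_mul_le_mul_left h6 (by linarith)
    · have hy1 : 1 ≤ 2 / (1 + p) := by rw [le_div_iff₀ (by linarith)]; linarith
      have hy2 : 2 / (1 + p) < γ := by
        refine lt_of_lt_of_le ?_ hγ2
        rw [div_lt_iff₀ (by linarith)]; linarith
      have hb := hbelow _ hy1 hy2
      have hl0 : 0 ≤ ε * (1 + p) / p := by positivity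
      have hl1 : ε * (1 + p) / p ≤ 1 := by rw [div_le_iff₀ hp0]; linarith
      have hm1 : (1 : ℝ) ∈ Set.Ici (0 : ℝ) := by simp
      have hm2 : 2 / (1 + p) ∈ Set.Ici (0 : ℝ) := by simp only [Set.mem_Ici]; linarith
      have hc := hconv.2 hm1 hm2 (sub_nonneg.mpr hl1) hl0 (by ring)
      simp only [smul_eq_mul, hf1, mul_zero, zero_add] at hc
      have hx : (1 - ε * (1 + p) / p) * 1 + ε * (1 + p) / p * (2 / (1 + p))
          = 1 - ε + ε / p := by
        field_simp; ring
      rw [hx] at hc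
      have h3 := mul_le_mul_of_nonneg_left hc hp0.le
      have h4 : p * (ε * (1 + p) / p * f (2 / (1 + p)))
          = (1 + p) / 2 * (2 * ε * f (2 / (1 + p))) := by field_simp
      have h5 := mul_le_mul_of_nonneg_left hb (show 0 ≤ (1 + p) / 2 by linarith)
      have h6 : (1 + p) / 2 * (C * (2 / (1 + p))) = C := by field_simp
      linarith
  refine ⟨hmain, ?_⟩
  have he : 1 + ε * (1 / p - 1) = 1 - ε + ε / p := by ring
  rw [he]
  have h0 := hnonneg (1 - ε) (by simp only [Set.mem_Ici]; linarith)
  nlinarith [mul_nonneg hp0.le h0]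
end

section
/- Let f : [0,∞) → [0,∞) be convex with f(1) = 0 and f′(1) = 0, and suppose f′(∞) := lim_{t→∞} f(t)/t is finite and positive. Let X = {0,1}, μ = δ₀ (the point mass at 0), and for q ∈ [0,1] let ν_q be the probability measure with ν_q({0}) = 1−q and ν_q({1}) = q. Then, with the f-divergence defined via the Lebesgue decomposition ν_q = (ν_q)_ac + (ν_q)_s with respect to μ as D_f(ν_q‖μ) = ∫ f(d(ν_q)_ac/dμ) dμ + f′(∞)·(ν_q)_s(X), one has D_f(ν_q‖μ) = f(1−q) + q·f′(∞). Moreover, for 0 < C < f′(∞), setting q = C/f′(∞) ∈ (0,1), for any ε > 0 with (1+ε)·(1−q) < 1−ε and for every natural number n, there is no measurable function φ : ℝⁿ → ℝ such that both |φ(1, …, 1) − 1| ≤ ε and |φ(1, …, 1) − 1/(1−q)| ≤ ε/(1−q); in particular, since every sample from μ equals 0 and the unnormalized density ratios for ν₀ = μ and ν_q may both be chosen to take the value 1 at 0 (with normalizing constants Z₀ = 1 and Z_q = 1/(1−q), respectively), no estimator based on finitely many samples from μ and their λ-values achieves a (1±ε)-multiplicative approximation of the normalizing constant in both scenarios. 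-/
open MeasureTheory Real
open scoped ENNReal

/-- The Bernoulli-type measure on `Bool` putting mass `1−q` on `false` and `q` on `true`. -/
noncomputable def nuq (q : ℝ) : Measure Bool :=
  ENNReal.ofReal (1 - q) • Measure.dirac false + ENNReal.ofReal q • Measure.dirac true

/-- Let `f` be convex and nonnegative on `[0,∞)` with `f(1) = 0`, `f'(1) = 0`,
and `f'(∞) = lim_{t→∞} f(t)/t = L ∈ (0,∞)`.  Let `X = {0,1}` (here `Bool`), `μ = δ₀`, and
for `q ∈ [0,1]` let `ν_q({0}) = 1−q`, `ν_q({1}) = q`.  Then, with the `f`-divergence defined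
via the Lebesgue decomposition of `ν_q` with respect to `μ`,
`D_f(ν_q‖μ) = ∫ f(d(ν_q)_ac/dμ) dμ + L·(ν_q)_s(X) = f(1−q) + q·L`.  Moreover, for
`0 < C < L`, setting `q = C/L`, for any `ε > 0` with `(1+ε)(1−q) < 1−ε` and any `n`, there
is no measurable `φ : ℝⁿ → ℝ` with both `|φ(1,…,1) − 1| ≤ ε` and
`|φ(1,…,1) − 1/(1−q)| ≤ ε/(1−q)`. -/
theorem stmt6 (f : ℝ → ℝ) (hconv : ConvexOn ℝ (Set.Ici 0) f)
    (hnonneg : ∀ t ∈ Set.Ici (0 : ℝ), 0 ≤ f t) (hf1 : f 1 = 0) (hf'1 : HasDerivAt f 0 1)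
    (L : ℝ) (hL : Filter.Tendsto (fun t => f t / t) Filter.atTop (nhds L)) (hL0 : 0 < L) :
    (∀ q ∈ Set.Icc (0 : ℝ) 1,
      (∫ x, f (((nuq q).rnDeriv (Measure.dirac false) x).toReal) ∂(Measure.dirac false))
        + L * (((nuq q).singularPart (Measure.dirac false)) Set.univ).toReal
      = f (1 - q) + q * L) ∧
    ∀ C : ℝ, 0 < C → C < L →
      ∀ ε : ℝ, 0 < ε → (1 + ε) * (1 - C / L) < 1 - ε →
        ∀ n : ℕ,
          ¬ ∃ φ : (Fin n → ℝ) → ℝ, Measurable φ ∧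
            |φ (fun _ => (1 : ℝ)) - 1| ≤ ε ∧
            |φ (fun _ => (1 : ℝ)) - 1 / (1 - C / L)| ≤ ε / (1 - C / L) := by
  constructor
  · rintro q ⟨hq0, hq1⟩
    have hs : (ENNReal.ofReal q • Measure.dirac true : Measure Bool) ⟂ₘ Measure.dirac false := by
      refine ⟨{false}, MeasurableSet.singleton _, ?_, ?_⟩ <;> simp
    have hadd : nuq q = (ENNReal.ofReal q • Measure.dirac true : Measure Bool)
        + (Measure.dirac false).withDensity (fun _ => ENNReal.ofReal (1 - q)) := by
      rw [withDensity_const, nuq, add_comm]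
    have h1 := Measure.eq_singularPart (measurable_const) hs hadd
    have h2 := Measure.eq_rnDeriv (measurable_const) hs hadd
    rw [← h1, integral_dirac]
    have h3 : (nuq q).rnDeriv (Measure.dirac false) false = ENNReal.ofReal (1 - q) := by
      rw [Filter.EventuallyEq, ae_dirac_eq] at h2
      exact (Filter.eventually_pure.mp h2).symm
    rw [h3, ENNReal.toReal_ofReal (by linarith)]
    simp [ENNReal.toReal_ofReal hq0, mul_comm]
  · rintro C hC hCL ε hε h n ⟨φ, -, ha, hb⟩
    have hp : 0 < 1 - C / L := by
      have := (div_lt_one hL0).mpr hCL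
      linarith
    have ha' := (abs_le.mp ha).2
    have hb' := (abs_le.mp hb).1
    have : (1 + ε) < (1 - ε) / (1 - C / L) := (lt_div_iff₀ hp).mpr h
    rw [sub_div] at this
    linarith
end

section
/- Let 0 < ε < 1/8, p = 1/2 and p′ = 1/2 − 2ε, and for s ∈ (0,1) let μ_s be the Bernoulli measure on {0,1} with μ_s({1}) = s. Let ν = δ₁; then for s ∈ {p, p′} the density dν/dμ_s is bounded by 4 μ_s-almost everywhere, and λ(x) = 1{x = 1} satisfies λ = Z_s·(dν/dμ_s) with normalizing constant Z_s = s. For every natural number n and every measurable function φ : {0,1}ⁿ → ℝ, if μ_p^{⊗n}( |φ − p| ≤ ε·p ) ≥ 2/3 and μ_{p′}^{⊗n}( |φ − p′| ≤ ε·p′ ) ≥ 2/3, then n ≥ 1/(36·ε²). -/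
open MeasureTheory Real
open scoped ENNReal

/-- The Bernoulli measure on `Bool` with success probability `s`:
mass `1−s` on `false`(=`0`) and mass `s` on `true`(=`1`). -/
noncomputable def bern (s : ℝ) : Measure Bool :=
  ENNReal.ofReal (1 - s) • Measure.dirac false + ENNReal.ofReal s • Measure.dirac true

/-- Bernoulli weight. -/
noncomputable def bw (s : ℝ) (b : Bool) : ℝ := if b then s else 1 - s

lemma bw_sum (s : ℝ) : ∑ b, bw s b = 1 := by simp [bw]

lemma bw_nonneg {s : ℝ} (h0 : 0 < s) (h1 : s < 1) (b : Bool) : 0 < bw s b := by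
  cases b <;> simp [bw] <;> linarith

lemma bern_finite (s : ℝ) : IsFiniteMeasure (bern s) := by
  constructor
  simp [bern]

lemma bern_singleton (s : ℝ) (b : Bool) : bern s {b} = ENNReal.ofReal (bw s b) := by
  cases b <;> simp [bern, bw]

lemma pi_bern (s : ℝ) (h0 : 0 < s) (h1 : s < 1) (n : ℕ) (B : Finset (Fin n → Bool)) :
    (Measure.pi fun _ : Fin n => bern s) (B : Set (Fin n → Bool)) =
      ENNReal.ofReal (∑ ω ∈ B, ∏ i, bw s (ω i)) := by
  have := bern_finite s
  rw [← sum_measure_singleton, ENNReal.ofReal_sum_of_nonneg]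
  · refine Finset.sum_congr rfl fun ω _ => ?_
    rw [Measure.pi_singleton, ENNReal.ofReal_prod_of_nonneg]
    · simp [bern_singleton]
    · intro i _; exact (bw_nonneg h0 h1 _).le
  · intro ω _; exact Finset.prod_nonneg fun i _ => (bw_nonneg h0 h1 _).le

lemma total (s : ℝ) (n : ℕ) : ∑ ω : Fin n → Bool, ∏ i, bw s (ω i) = 1 := by
  have := Finset.prod_univ_sum (fun _ : Fin n => (Finset.univ : Finset Bool)) (fun _ b => bw s b)
  rw [Fintype.piFinset_univ] at this
  rw [← this]; simp only [bw_sum, Finset.prod_const_one]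

lemma marg (s : ℝ) (n : ℕ) (g : Bool → ℝ) (j : Fin n) :
    ∑ ω : Fin n → Bool, (∏ i, bw s (ω i)) * g (ω j) = ∑ b, bw s b * g b := by
  have := Finset.prod_univ_sum (fun _ : Fin n => (Finset.univ : Finset Bool))
    (fun i b => bw s b * (if i = j then g b else 1))
  rw [Fintype.piFinset_univ] at this
  have h2 : ∀ ω : Fin n → Bool, ∏ i, (bw s (ω i) * (if i = j then g (ω i) else 1))
      = (∏ i, bw s (ω i)) * g (ω j) := by
    intro ω
    rw [Finset.prod_mul_distrib]; simp
  rw [Finset.sum_congr rfl (fun ω _ => h2 ω)] at this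
  rw [← this]
  rw [Finset.prod_eq_single j]
  · simp
  · intro i _ hi; simp only [hi, if_false, mul_one]; exact bw_sum s
  · simp

lemma kl_bound (x : ℝ) (h0 : 0 < x) (h1 : x ^ 2 ≤ 4 / 27) :
    (1 - x) * log (1 - x) + (1 + x) * log (1 + x) ≤ 1.039 * x ^ 2 := by
  have hx : x < 0.385 := by nlinarith
  have a1 := Real.abs_log_sub_add_sum_range_le (x := x) (by rw [abs_of_pos h0]; linarith) 7
  have a2 := Real.abs_log_sub_add_sum_range_le (x := -x)
    (by rw [abs_neg, abs_of_pos h0]; linarith) 7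
  rw [abs_neg] at a2
  rw [abs_of_pos h0] at a1 a2
  have e : x ^ (7 + 1) / (1 - x) ≤ 0.0053 * x ^ 2 := by
    rw [div_le_iff₀ (by linarith)]
    have : x ^ 6 ≤ (4 / 27) ^ 3 := by
      calc x ^ 6 = (x ^ 2) ^ 3 := by ring
        _ ≤ _ := by gcongr
    have h8 : x ^ (7 + 1) ≤ (4 / 27) ^ 3 * x ^ 2 := by
      calc x ^ (7 + 1) = x ^ 6 * x ^ 2 := by ring
        _ ≤ _ := by gcongr
    have : 0.0053 * x ^ 2 * 0.615 ≤ 0.0053 * x ^ 2 * (1 - x) := by gcongr; linarith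
    nlinarith [sq_nonneg x]
  have b1 := (le_abs_self _).trans (a1.trans e)
  have b2 := (le_abs_self _).trans (a2.trans e)
  rw [sub_neg_eq_add] at b2
  simp only [Finset.sum_range_succ, Finset.sum_range_zero] at b1 b2
  norm_num at b1 b2
  have c1 := mul_le_mul_of_nonneg_left b1 (by linarith : 0 ≤ 1 - x)
  have c2 := mul_le_mul_of_nonneg_left b2 (by linarith : 0 ≤ 1 + x)
  have h4 : x ^ 4 ≤ 4 / 27 * x ^ 2 := by nlinarith [sq_nonneg x]
  have h6 : x ^ 6 ≤ (4 / 27) ^ 2 * x ^ 2 := by nlinarith [sq_nonneg x]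
  have h8 : 0 ≤ x ^ 8 := by positivity
  nlinarith

lemma gibbs (s : ℝ) (h0 : 0 < s) (h1 : s < 1) (n : ℕ) (B : Finset (Fin n → Bool))
    (hP : ∑ ω ∈ B, ∏ i, bw (1 / 2) (ω i) ≤ 1 / 3)
    (hQ : 2 / 3 ≤ ∑ ω ∈ B, ∏ i, bw s (ω i)) :
    1 / 3 * log 2 ≤ n * ∑ b, bw s b * log (bw s b / bw (1 / 2) b) := by
  classical
  set Q : (Fin n → Bool) → ℝ := fun ω => ∏ i, bw s (ω i) with hQd
  set P : (Fin n → Bool) → ℝ := fun ω => ∏ i, bw (1 / 2) (ω i) with hPd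
  have Qp : ∀ ω, 0 < Q ω := fun ω => Finset.prod_pos fun i _ => bw_nonneg h0 h1 _
  have Pp : ∀ ω, 0 < P ω := fun ω =>
    Finset.prod_pos fun i _ => bw_nonneg (by norm_num) (by norm_num) _
  have tens : ∑ ω, Q ω * log (Q ω / P ω) = n * ∑ b, bw s b * log (bw s b / bw (1 / 2) b) := by
    have : ∀ ω, Q ω * log (Q ω / P ω) = ∑ j, Q ω * log (bw s (ω j) / bw (1 / 2) (ω j)) := by
      intro ω
      rw [← Finset.mul_sum, ← Real.log_prod, ← Finset.prod_div_distrib]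
      intro i _
      exact (div_pos (bw_nonneg h0 h1 _) (bw_nonneg (by norm_num) (by norm_num) _)).ne'
    rw [Finset.sum_congr rfl fun ω _ => this ω, Finset.sum_comm]
    rw [Finset.sum_congr rfl fun j _ => marg s n (fun b => log (bw s b / bw (1 / 2) b)) j]
    rw [Finset.sum_const, Finset.card_univ, Fintype.card_fin, nsmul_eq_mul]
  rw [← tens]
  have key : ∀ ω, (if ω ∈ B then Q ω * (2 * log 2) else 0) - Q ω * log 2 - Q ω * log (Q ω / P ω)
      ≤ P ω / 2 + (if ω ∈ B then 3 / 2 * P ω else 0) - Q ω := by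
    intro ω
    have q := Qp ω
    have p := Pp ω
    rw [Real.log_div q.ne' p.ne']
    by_cases h : ω ∈ B
    · simp only [h, if_true]
      have l := Real.log_le_sub_one_of_pos (x := 2 * P ω / Q ω) (by positivity)
      rw [Real.log_div (by positivity) q.ne', Real.log_mul (by norm_num) p.ne'] at l
      have := mul_le_mul_of_nonneg_left l q.le
      have e : Q ω * (2 * P ω / Q ω - 1) = 2 * P ω - Q ω := by field_simp
      rw [e] at this
      linarith
    · simp only [h, if_false]
      have l := Real.log_le_sub_one_of_pos (x := P ω / 2 / Q ω) (by positivity)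
      rw [Real.log_div (by positivity) q.ne', Real.log_div p.ne' (by norm_num)] at l
      have := mul_le_mul_of_nonneg_left l q.le
      have e : Q ω * (P ω / 2 / Q ω - 1) = P ω / 2 - Q ω := by field_simp
      rw [e] at this
      linarith
  have S := Finset.sum_le_sum fun ω (_ : ω ∈ Finset.univ) => key ω
  simp only [Finset.sum_sub_distrib, Finset.sum_add_distrib, Finset.sum_ite_mem,
    Finset.univ_inter, ← Finset.sum_mul, ← Finset.mul_sum, ← Finset.sum_div] at S
  have tQ : ∑ ω, Q ω = 1 := total s n
  have tP : ∑ ω, P ω = 1 := total (1 / 2) n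
  rw [tQ, tP] at S
  have l2 : 0 < log 2 := Real.log_pos (by norm_num)
  nlinarith

lemma core (x : ℝ) (h0 : 0 < x) (h1 : x < 1 / 2) (n : ℕ) (B : Finset (Fin n → Bool))
    (hP : ∑ ω ∈ B, ∏ i, bw (1 / 2) (ω i) ≤ 1 / 3)
    (hQ : 2 / 3 ≤ ∑ ω ∈ B, ∏ i, bw ((1 - x) / 2) (ω i)) :
    4 / 9 ≤ n * x ^ 2 := by
  by_contra hc
  push Not at hc
  by_cases hn : 3 ≤ n
  · have hn' : (3 : ℝ) ≤ n := by exact_mod_cast hn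
    have hx2 : x ^ 2 ≤ 4 / 27 := by nlinarith [sq_nonneg x]
    have g := gibbs _ (by linarith) (by linarith) n B hP hQ
    have k := kl_bound x h0 hx2
    have e : ∑ b, bw ((1 - x) / 2) b * log (bw ((1 - x) / 2) b / bw (1 / 2) b)
        = ((1 - x) * log (1 - x) + (1 + x) * log (1 + x)) / 2 := by
      simp only [Fintype.sum_bool, bw]
      simp only [if_true, Bool.false_eq_true, if_false]
      rw [show (1 - x) / 2 / (1 / 2) = 1 - x by ring,
        show (1 - (1 - x) / 2) / (1 - 1 / 2) = 1 + x by ring]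
      ring
    rw [e] at g
    have := mul_le_mul_of_nonneg_left k (by linarith : (0 : ℝ) ≤ n)
    have := Real.log_two_gt_d9
    nlinarith
  · have hb : ∀ b, bw (1 / 2) b = 1 / 2 := by intro b; cases b <;> norm_num [bw]
    simp only [hb, Finset.prod_const, Finset.sum_const, Finset.card_univ, Fintype.card_fin,
      nsmul_eq_mul] at hP
    have hb2 : ∀ b, bw ((1 - x) / 2) b ≤ 3 / 4 := by
      intro b; cases b <;> simp [bw] <;> linarith
    have hs : ∑ ω ∈ B, ∏ i, bw ((1 - x) / 2) (ω i) ≤ B.card * (3 / 4) ^ n := by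
      calc _ ≤ ∑ ω ∈ B, (3 / 4 : ℝ) ^ n := by
            refine Finset.sum_le_sum fun ω _ => ?_
            calc _ ≤ ∏ i : Fin n, (3 / 4 : ℝ) :=
                  Finset.prod_le_prod
                    (fun i _ => (bw_nonneg (by linarith) (by linarith) _).le) (fun i _ => hb2 _)
              _ = _ := by rw [Finset.prod_const, Finset.card_univ, Fintype.card_fin]
        _ = _ := by simp
    have hs2 := hQ.trans hs
    have hn3 : n < 3 := by omega
    generalize B.card = m at hs2 hP
    have hm : m ≤ 1 := by
      by_contra hm
      have : (2 : ℝ) ≤ m := by exact_mod_cast (by omega : 2 ≤ m)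
      interval_cases n <;> (norm_num at hP; try linarith)
    clear hs hQ hc
    interval_cases n <;> interval_cases m <;> first | (norm_num at hP; done) | (norm_num at hs2; done)

lemma part_one (s : ℝ) (h0 : 1 / 4 ≤ s) (h1 : s < 1) :
    (∀ᵐ x ∂(bern s), ((Measure.dirac true).rnDeriv (bern s) x).toReal ≤ 4) ∧
      (∀ᵐ x ∂(bern s),
        (if x = true then (1 : ℝ) else 0) =
          s * ((Measure.dirac true).rnDeriv (bern s) x).toReal) := by
  have := bern_finite s
  have hs : 0 < s := by linarith
  let f : Bool → ℝ≥0∞ := fun b => if b then ENNReal.ofReal (1 / s) else 0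
  have hd : Measure.dirac true = (bern s).withDensity f := by
    refine Measure.ext_of_singleton fun b => ?_
    rw [withDensity_apply _ (measurableSet_singleton b), lintegral_singleton, bern_singleton]
    cases b
    · simp [f]
    · simp only [f, bw, if_true]
      rw [← ENNReal.ofReal_mul (by positivity)]
      simp [hs.ne']
  have hr : (Measure.dirac true).rnDeriv (bern s) =ᵐ[bern s] f := by
    rw [hd]; exact Measure.rnDeriv_withDensity _ (measurable_of_finite f)
  constructor
  · filter_upwards [hr] with x hx
    rw [hx]
    cases x
    · simp [f]
    · simp only [f, if_true]
      rw [ENNReal.toReal_ofReal (by positivity), div_le_iff₀ hs]; linarith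
  · filter_upwards [hr] with x hx
    rw [hx]
    cases x
    · simp [f]
    · simp only [f, if_true]
      rw [ENNReal.toReal_ofReal (by positivity)]; field_simp

/-- Let `0 < ε < 1/8`, `p = 1/2`, `p' = 1/2 − 2ε`, `μ_s` the Bernoulli measure
with `μ_s({1}) = s`, and `ν = δ₁`.  Then for `s ∈ {p, p'}` the density `dν/dμ_s` is bounded
by `4` `μ_s`-a.e., and `λ(x) = 1{x = 1}` satisfies `λ = Z_s·(dν/dμ_s)` a.e., with
normalizing constant `Z_s = s`.  Moreover, for every `n` and measurable `φ : {0,1}ⁿ → ℝ`,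
if `μ_p^{⊗n}(|φ − p| ≤ ε·p) ≥ 2/3` and `μ_{p'}^{⊗n}(|φ − p'| ≤ ε·p') ≥ 2/3`, then
`n ≥ 1/(36·ε²)`. -/
theorem stmt7 (ε : ℝ) (hε0 : 0 < ε) (hε1 : ε < 1 / 8) :
    (∀ s ∈ ({1 / 2, 1 / 2 - 2 * ε} : Set ℝ),
      (∀ᵐ x ∂(bern s), ((Measure.dirac true).rnDeriv (bern s) x).toReal ≤ 4) ∧
      (∀ᵐ x ∂(bern s),
        (if x = true then (1 : ℝ) else 0) = s * ((Measure.dirac true).rnDeriv (bern s) x).toReal)) ∧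
    ∀ (n : ℕ) (φ : (Fin n → Bool) → ℝ), Measurable φ →
      (2 / 3 : ℝ≥0∞) ≤ (Measure.pi fun _ : Fin n => bern (1 / 2))
          {ω | |φ ω - 1 / 2| ≤ ε * (1 / 2)} →
      (2 / 3 : ℝ≥0∞) ≤ (Measure.pi fun _ : Fin n => bern (1 / 2 - 2 * ε))
          {ω | |φ ω - (1 / 2 - 2 * ε)| ≤ ε * (1 / 2 - 2 * ε)} →
      1 / (36 * ε ^ 2) ≤ (n : ℝ) := by
  constructor
  · intro s hs
    simp only [Set.mem_insert_iff, Set.mem_singleton_iff] at hs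
    rcases hs with rfl | rfl
    · exact part_one _ (by norm_num) (by norm_num)
    · exact part_one _ (by linarith) (by linarith)
  · intro n φ _ hA hB
    classical
    set A : Finset (Fin n → Bool) :=
      Finset.univ.filter fun ω => |φ ω - 1 / 2| ≤ ε * (1 / 2) with hAd
    set B : Finset (Fin n → Bool) :=
      Finset.univ.filter fun ω => |φ ω - (1 / 2 - 2 * ε)| ≤ ε * (1 / 2 - 2 * ε) with hBd
    have eA : {ω | |φ ω - 1 / 2| ≤ ε * (1 / 2)} = (A : Set (Fin n → Bool)) := by
      ext ω; simp [hAd]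
    have eB : {ω | |φ ω - (1 / 2 - 2 * ε)| ≤ ε * (1 / 2 - 2 * ε)}
        = (B : Set (Fin n → Bool)) := by
      ext ω; simp [hBd]
    rw [eA, pi_bern _ (by norm_num) (by norm_num)] at hA
    rw [eB, pi_bern _ (by linarith) (by linarith)] at hB
    have e23 : (2 / 3 : ℝ≥0∞) = ENNReal.ofReal (2 / 3) := by
      rw [ENNReal.ofReal_div_of_pos (by norm_num)]; simp
    rw [e23, ENNReal.ofReal_le_ofReal_iff'] at hA hB
    replace hA := hA.resolve_right (by norm_num)
    replace hB := hB.resolve_right (by norm_num)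
    have hdis : Disjoint A B := by
      rw [Finset.disjoint_left]
      intro ω h1 h2
      simp only [hAd, hBd, Finset.mem_filter, Finset.mem_univ, true_and, abs_le] at h1 h2
      nlinarith [h1.1, h2.2]
    have hP : ∑ ω ∈ B, ∏ i, bw (1 / 2) (ω i) ≤ 1 / 3 := by
      have h : ∑ ω ∈ A ∪ B, ∏ i, bw (1 / 2) (ω i) ≤ 1 := by
        refine le_trans ?_ (total (1 / 2) n).le
        exact Finset.sum_le_sum_of_subset_of_nonneg (Finset.subset_univ _) fun ω _ _ =>
          Finset.prod_nonneg fun i _ => (bw_nonneg (by norm_num) (by norm_num) _).le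
      rw [Finset.sum_union hdis] at h
      linarith
    have hc := core (4 * ε) (by linarith) (by linarith) n B hP
      (by rw [show (1 - 4 * ε) / 2 = 1 / 2 - 2 * ε by ring]; exact hB)
    rw [div_le_iff₀ (by positivity)]
    nlinarith
end

section
/- Let μ, ν be probability measures on a measurable space X with ν ≪ μ and r = dν/dμ. Let 0 < ε < 1, 0 < u < 1 and M > 0 satisfy Cov_M(ν‖μ) ≤ u·ε. Then μ({x : r(x) ≥ 1 − ε}) ≥ (1 − u)·ε/M. -/
open MeasureTheory Real
open scoped ENNReal

lemma real_le_of_rnd_le {X : Type*} [MeasurableSpace X] (μ ν : Measure X)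
    [IsProbabilityMeasure μ] [IsProbabilityMeasure ν] (hac : ν ≪ μ) (c : ℝ) (S : Set X)
    (hS : MeasurableSet S) (h : ∀ x ∈ S, rnd μ ν x ≤ c) : ν.real S ≤ c * μ.real S := by
  rw [← Measure.setIntegral_toReal_rnDeriv hac S]
  have h1 : ∫ x in S, (ν.rnDeriv μ x).toReal ∂μ ≤ ∫ _x in S, c ∂μ :=
    setIntegral_mono_on Measure.integrable_toReal_rnDeriv.integrableOn
      (integrable_const c).integrableOn hS h
  rw [setIntegral_const, smul_eq_mul, mul_comm] at h1
  exact h1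

/-- Generalized Paley–Zygmund via coverage: Let `ν ≪ μ` be probability
measures with `r = dν/dμ`, let `0 < ε < 1`, `0 < u < 1`, and `M > 0` with
`Cov_M(ν‖μ) ≤ u·ε`.  Then `μ({x : r(x) ≥ 1 − ε}) ≥ (1 − u)·ε/M`. -/
theorem stmt11 {X : Type*} [MeasurableSpace X] (μ ν : Measure X)
    [IsProbabilityMeasure μ] [IsProbabilityMeasure ν] (hac : ν ≪ μ)
    (ε u M : ℝ) (hε0 : 0 < ε) (hε1 : ε < 1) (hu0 : 0 < u) (hu1 : u < 1) (hM : 0 < M)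
    (hcov : Cov μ ν M ≤ u * ε) :
    (1 - u) * ε / M ≤ (μ {x | 1 - ε ≤ rnd μ ν x}).toReal := by
  have hm : Measurable (rnd μ ν) := (Measure.measurable_rnDeriv ν μ).ennreal_toReal
  have hA : MeasurableSet {x | 1 - ε ≤ rnd μ ν x} := measurableSet_le measurable_const hm
  have hB : MeasurableSet {x | M ≤ rnd μ ν x} := measurableSet_le measurable_const hm
  change ν.real {x | M ≤ rnd μ ν x} ≤ u * ε at hcov
  change _ ≤ μ.real {x | 1 - ε ≤ rnd μ ν x}
  set A := {x | 1 - ε ≤ rnd μ ν x} with hAdef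
  set B := {x | M ≤ rnd μ ν x} with hBdef
  have h1 : ν.real A + ν.real Aᶜ = 1 := by
    rw [measureReal_add_measureReal_compl hA]; simp
  have h2 : ν.real Aᶜ ≤ (1 - ε) * μ.real Aᶜ :=
    real_le_of_rnd_le μ ν hac _ _ hA.compl fun x hx => le_of_not_ge (fun h => hx h)
  have h3 : ν.real (A \ B) ≤ M * μ.real (A \ B) :=
    real_le_of_rnd_le μ ν hac _ _ (hA.diff hB) fun x hx => (not_le.mp hx.2).le
  have h4 : ν.real A ≤ ν.real B + ν.real (A \ B) :=
    (measureReal_mono (by intro x hx; by_cases hb : x ∈ B <;> simp [hb, hx])).trans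
      (measureReal_union_le B (A \ B))
  have h5 : μ.real (A \ B) ≤ μ.real A := measureReal_mono Set.sdiff_subset
  have h6 : μ.real Aᶜ ≤ 1 := measureReal_le_one
  rw [div_le_iff₀ hM]
  nlinarith [mul_le_mul_of_nonneg_left h5 hM.le,
    mul_le_mul_of_nonneg_left h6 (sub_nonneg.mpr hε1.le)]
end

section
/- Let μ, ν be probability measures on a measurable space X with ν ≪ μ and r = dν/dμ, and let f : [0,∞) → [0,∞) be convex with f(1) = 0 and f′(1) = 0. For any 0 < ε < 1, 0 < u < 1, and any real t > 1 with f(t) > 0 and f(t)/t ≥ D_f(ν‖μ)/(u·ε), it holds that μ({x : r(x) ≥ 1 − ε}) ≥ (1 − u)·ε/t. -/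
open MeasureTheory Real
open scoped ENNReal

/-- The `f`-divergence `D_f(ν‖μ) = ∫ f(dν/dμ) dμ`, valued in `ℝ≥0∞` (so possibly `∞`). -/
noncomputable def fDivE {X : Type*} [MeasurableSpace X] (f : ℝ → ℝ) (μ ν : Measure X) :
    ℝ≥0∞ :=
  ∫⁻ x, ENNReal.ofReal (f (rnd μ ν x)) ∂μ

/-- Generalized Paley–Zygmund via `f`-divergence: Let `ν ≪ μ` be probability
measures with `r = dν/dμ`, and let `f` be convex and nonnegative on `[0,∞)` with `f(1) = 0`
and `f'(1) = 0`.  For any `0 < ε < 1`, `0 < u < 1`, and any real `t > 1` with `f(t) > 0` and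
`f(t)/t ≥ D_f(ν‖μ)/(u·ε)`, it holds that `μ({x : r(x) ≥ 1 − ε}) ≥ (1 − u)·ε/t`. -/
theorem stmt12 {X : Type*} [MeasurableSpace X] (μ ν : Measure X)
    [IsProbabilityMeasure μ] [IsProbabilityMeasure ν] (hac : ν ≪ μ)
    (f : ℝ → ℝ) (hconv : ConvexOn ℝ (Set.Ici 0) f)
    (hnonneg : ∀ s ∈ Set.Ici (0 : ℝ), 0 ≤ f s) (hf1 : f 1 = 0) (hf'1 : HasDerivAt f 0 1)
    (ε u t : ℝ) (hε0 : 0 < ε) (hε1 : ε < 1) (hu0 : 0 < u) (hu1 : u < 1)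
    (ht : 1 < t) (hft : 0 < f t)
    (hDf : fDivE f μ ν ≤ ENNReal.ofReal (u * ε * (f t / t))) :
    (1 - u) * ε / t ≤ (μ {x | 1 - ε ≤ rnd μ ν x}).toReal := by
  have hm : Measurable (rnd μ ν) := (Measure.measurable_rnDeriv ν μ).ennreal_toReal
  have hA : MeasurableSet {x | 1 - ε ≤ rnd μ ν x} := measurableSet_le measurable_const hm
  have ht0 : 0 < t := by linarith
  have hr0 : ∀ x, 0 ≤ rnd μ ν x := fun x => ENNReal.toReal_nonneg
  -- `f s / s ≥ f t / t` for `s ≥ t`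
  have key : ∀ s, t ≤ s → s ≤ t / f t * f s := by
    intro s hs
    have h1 : f t * (s - 1) ≤ f s * (t - 1) := by
      have hs1 : 0 < s - 1 := by linarith
      have h := hconv.2 (show (1 : ℝ) ∈ Set.Ici 0 by simp)
        (show s ∈ Set.Ici (0 : ℝ) from by simp only [Set.mem_Ici]; linarith)
        (show 0 ≤ (s - t) / (s - 1) from div_nonneg (by linarith) hs1.le)
        (show 0 ≤ (t - 1) / (s - 1) from div_nonneg (by linarith) hs1.le)
        (by field_simp; ring)
      have e : ((s - t) / (s - 1)) • (1 : ℝ) + ((t - 1) / (s - 1)) • s = t := by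
        simp only [smul_eq_mul]; field_simp; ring
      rw [e, hf1] at h
      simp only [smul_eq_mul, mul_zero, zero_add] at h
      rw [div_mul_eq_mul_div, le_div_iff₀ hs1] at h
      linarith
    have h2 : s * f t ≤ t * f s := by
      have h3 : (s * f t) * (t - 1) ≤ (t * f s) * (t - 1) := by
        have h4 : s * (t - 1) ≤ t * (s - 1) := by linarith
        have h5 := mul_le_mul_of_nonneg_left h4 hft.le
        have h6 := mul_le_mul_of_nonneg_left h1 ht0.le
        linarith
      exact le_of_mul_le_mul_right h3 (by linarith)
    rw [div_mul_eq_mul_div, le_div_iff₀ hft]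
    exact h2
  have hpt : ∀ x, ENNReal.ofReal (rnd μ ν x) ≤ ENNReal.ofReal (1 - ε) +
      (({x | 1 - ε ≤ rnd μ ν x}.indicator (fun _ => ENNReal.ofReal t) x) +
      ENNReal.ofReal (t / f t) * ENNReal.ofReal (f (rnd μ ν x))) := by
    intro x
    by_cases h1 : 1 - ε ≤ rnd μ ν x
    · by_cases h2 : t ≤ rnd μ ν x
      · rw [← ENNReal.ofReal_mul (by positivity)]
        exact (ENNReal.ofReal_le_ofReal (key _ h2)).trans
          (le_add_left (le_add_left le_rfl))
      · rw [Set.indicator_of_mem (show x ∈ {x | 1 - ε ≤ rnd μ ν x} from h1)]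
        exact (ENNReal.ofReal_le_ofReal (not_le.1 h2).le).trans
          (le_add_left (le_add_right le_rfl))
    · exact (ENNReal.ofReal_le_ofReal (not_le.1 h1).le).trans (le_add_right le_rfl)
  have hone : ∫⁻ x, ENNReal.ofReal (rnd μ ν x) ∂μ = 1 := by
    have : ∫⁻ x, ENNReal.ofReal (rnd μ ν x) ∂μ = ∫⁻ x, ν.rnDeriv μ x ∂μ := by
      apply lintegral_congr_ae
      filter_upwards [Measure.rnDeriv_lt_top ν μ] with x hx
      exact ENNReal.ofReal_toReal hx.ne
    rw [this, Measure.lintegral_rnDeriv hac, measure_univ]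
  have hint := lintegral_mono (μ := μ) hpt
  rw [hone, lintegral_add_left measurable_const,
    lintegral_add_left (measurable_const.indicator hA), lintegral_indicator_const hA,
    lintegral_const_mul' _ _ ENNReal.ofReal_ne_top, lintegral_const, measure_univ, mul_one] at hint
  have hD : ENNReal.ofReal (t / f t) * ∫⁻ x, ENNReal.ofReal (f (rnd μ ν x)) ∂μ
      ≤ ENNReal.ofReal (u * ε) := by
    calc _ ≤ ENNReal.ofReal (t / f t) * ENNReal.ofReal (u * ε * (f t / t)) := by
            gcongr; exact hDf
      _ = ENNReal.ofReal (u * ε) := by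
            rw [← ENNReal.ofReal_mul (by positivity)]
            congr 1
            field_simp
  have hfin : (1 : ℝ≥0∞) ≤ ENNReal.ofReal (1 - ε + (t * (μ {x | 1 - ε ≤ rnd μ ν x}).toReal
      + u * ε)) := by
    have h1 : 0 ≤ t * (μ {x | 1 - ε ≤ rnd μ ν x}).toReal :=
      mul_nonneg ht0.le ENNReal.toReal_nonneg
    have h2 : 0 ≤ u * ε := by positivity
    rw [ENNReal.ofReal_add (by linarith) (by linarith), ENNReal.ofReal_add h1 h2,
      ENNReal.ofReal_mul ht0.le, ENNReal.ofReal_toReal (measure_ne_top _ _)]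
    exact hint.trans (by gcongr)
  rw [ENNReal.one_le_ofReal] at hfin
  rw [div_le_iff₀ ht0]
  linarith
end

section
/- Let μ, ν be probability measures on a measurable space X with ν ≪ μ and r = dν/dμ, and let f : [0,∞) → [0,∞) be convex with f(1) = 0 and f′(1) = 0. Then for every M > 1 with f(M) > 0, it holds that Cov_M(ν‖μ) ≤ M·D_f(ν‖μ)/f(M). -/
open MeasureTheory Real
open scoped ENNReal

/-- Coverage bound via `f`-divergence: Let `ν ≪ μ` be probability measures
with `r = dν/dμ`, and let `f` be convex and nonnegative on `[0,∞)` with `f(1) = 0` and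
`f'(1) = 0`.  Then for every `M > 1` with `f(M) > 0`,
`Cov_M(ν‖μ) = ν {r ≥ M} ≤ M·D_f(ν‖μ)/f(M)`. -/
theorem stmt14 {X : Type*} [MeasurableSpace X] (μ ν : Measure X)
    [IsProbabilityMeasure μ] [IsProbabilityMeasure ν] (hac : ν ≪ μ)
    (f : ℝ → ℝ) (hconv : ConvexOn ℝ (Set.Ici 0) f)
    (hnonneg : ∀ s ∈ Set.Ici (0 : ℝ), 0 ≤ f s) (hf1 : f 1 = 0) (hf'1 : HasDerivAt f 0 1)
    (M : ℝ) (hM : 1 < M) (hfM : 0 < f M) :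
    ν {x | M ≤ rnd μ ν x} ≤ ENNReal.ofReal (M / f M) * fDivE f μ ν := by
  have key : ∀ r : ℝ, M ≤ r → r ≤ M / f M * f r := by
    intro r hr
    have hr1 : 0 < r - 1 := by linarith
    have h := hconv.2 (show (1:ℝ) ∈ Set.Ici 0 by simp)
      (show r ∈ Set.Ici (0:ℝ) by simp only [Set.mem_Ici]; linarith)
      (show 0 ≤ (r - M) / (r - 1) from div_nonneg (by linarith) hr1.le)
      (show 0 ≤ (M - 1) / (r - 1) from div_nonneg (by linarith) hr1.le)
      (by field_simp; ring)
    have e : (r - M) / (r - 1) * 1 + (M - 1) / (r - 1) * r = M := by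
      field_simp; ring
    simp only [smul_eq_mul] at h
    rw [e, hf1, mul_zero, zero_add, div_mul_eq_mul_div, le_div_iff₀ hr1] at h
    have hfr : 0 ≤ f r := hnonneg r (by simp only [Set.mem_Ici]; linarith)
    rw [div_mul_eq_mul_div, le_div_iff₀ hfM]
    have h2 : f M * (r - 1) * r ≤ M * f r * (r - 1) := by
      nlinarith [mul_le_mul_of_nonneg_right h (show 0 ≤ r by linarith),
        mul_nonneg hfr (show 0 ≤ r - M by linarith)]
    have h3 : r * f M * (r - 1) ≤ M * f r * (r - 1) := by linarith
    exact le_of_mul_le_mul_right h3 hr1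
  have hmeas : MeasurableSet {x | M ≤ rnd μ ν x} :=
    measurableSet_le measurable_const (Measure.measurable_rnDeriv ν μ).ennreal_toReal
  rw [← Measure.setLIntegral_rnDeriv hac, fDivE,
    ← lintegral_const_mul' _ _ ENNReal.ofReal_ne_top]
  refine le_trans (lintegral_mono_ae ?_) (setLIntegral_le_lintegral {x | M ≤ rnd μ ν x} _)
  filter_upwards [ae_restrict_mem hmeas, ae_restrict_of_ae (Measure.rnDeriv_lt_top ν μ)]
    with x hx hlt
  rw [← ENNReal.ofReal_mul (div_nonneg (by linarith) hfM.le), ← ENNReal.ofReal_toReal hlt.ne]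
  exact ENNReal.ofReal_le_ofReal (key _ hx)
end

section
/- Let f : [0,∞) → [0,∞) be convex with f(1) = 0 and f′(1) = 0, let c > 1 and M ≥ c with f(M) > 0, and suppose f(M)/M² ≤ f(t)/t² for all t ∈ [c, M]. Then for any probability measures μ, ν on a measurable space X with ν ≪ μ and r = dν/dμ, it holds that ∫ r(x)²·1{r(x) ≤ M} dμ(x) ≤ c² + 2·M²·D_f(ν‖μ)/f(M). -/
open MeasureTheory Real
open scoped ENNReal

/-- Truncated second moment via `f`-divergence: Let `f` be convex and
nonnegative on `[0,∞)` with `f(1) = 0` and `f'(1) = 0`, let `c > 1` and `M ≥ c` with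
`f(M) > 0`, and suppose `f(M)/M² ≤ f(t)/t²` for all `t ∈ [c, M]`.  Then for any probability
measures `ν ≪ μ` with `r = dν/dμ`,
`∫ r(x)²·1{r(x) ≤ M} dμ(x) ≤ c² + 2·M²·D_f(ν‖μ)/f(M)`. -/
theorem stmt16 (f : ℝ → ℝ) (hconv : ConvexOn ℝ (Set.Ici 0) f)
    (hnonneg : ∀ s ∈ Set.Ici (0 : ℝ), 0 ≤ f s) (hf1 : f 1 = 0) (hf'1 : HasDerivAt f 0 1)
    (c M : ℝ) (hc : 1 < c) (hM : c ≤ M) (hfM : 0 < f M)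
    (hquad : ∀ t ∈ Set.Icc c M, f M / M ^ 2 ≤ f t / t ^ 2)
    {X : Type*} [MeasurableSpace X] (μ ν : Measure X)
    [IsProbabilityMeasure μ] [IsProbabilityMeasure ν] (hac : ν ≪ μ) :
    (∫⁻ x in {y | rnd μ ν y ≤ M}, ENNReal.ofReal ((rnd μ ν x) ^ 2) ∂μ)
      ≤ ENNReal.ofReal (c ^ 2) + ENNReal.ofReal (2 * M ^ 2 / f M) * fDivE f μ ν := by
  have hmeas : Measurable (rnd μ ν) := (Measure.measurable_rnDeriv ν μ).ennreal_toReal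
  have hset : MeasurableSet {y | rnd μ ν y ≤ M} := measurableSet_le hmeas measurable_const
  have hMpos : 0 < M := by linarith
  have hK : 0 ≤ 2 * M ^ 2 / f M := by positivity
  have hpt : ∀ t : ℝ, 0 ≤ t → t ≤ M → t ^ 2 ≤ c ^ 2 + 2 * M ^ 2 / f M * f t := by
    intro t ht htM
    have hft : 0 ≤ f t := hnonneg t ht
    rcases le_total t c with h | h
    · have h1 : t ^ 2 ≤ c ^ 2 := by gcongr
      have h2 := mul_nonneg hK hft
      linarith
    · have htpos : 0 < t := by linarith
      have h1 := hquad t ⟨h, htM⟩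
      rw [div_le_div_iff₀ (by positivity) (by positivity)] at h1
      have h2 : t ^ 2 ≤ M ^ 2 / f M * f t := by
        rw [div_mul_eq_mul_div, le_div_iff₀ hfM]
        linarith
      have h3 : 0 ≤ t ^ 2 := sq_nonneg t
      have h4 : 2 * M ^ 2 / f M * f t = 2 * (M ^ 2 / f M * f t) := by ring
      have h5 : 0 ≤ c ^ 2 := sq_nonneg c
      linarith
  calc (∫⁻ x in {y | rnd μ ν y ≤ M}, ENNReal.ofReal ((rnd μ ν x) ^ 2) ∂μ)
      ≤ ∫⁻ x in {y | rnd μ ν y ≤ M}, (ENNReal.ofReal (c ^ 2)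
          + ENNReal.ofReal (2 * M ^ 2 / f M) * ENNReal.ofReal (f (rnd μ ν x))) ∂μ := by
        refine setLIntegral_mono' hset fun x hx => ?_
        have h0 : 0 ≤ rnd μ ν x := ENNReal.toReal_nonneg
        rw [← ENNReal.ofReal_mul hK, ← ENNReal.ofReal_add (sq_nonneg c)
          (mul_nonneg hK (hnonneg _ h0))]
        exact ENNReal.ofReal_le_ofReal (hpt _ h0 hx)
    _ ≤ ∫⁻ x, (ENNReal.ofReal (c ^ 2)
          + ENNReal.ofReal (2 * M ^ 2 / f M) * ENNReal.ofReal (f (rnd μ ν x))) ∂μ :=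
        setLIntegral_le_lintegral _ _
    _ = ENNReal.ofReal (c ^ 2) + ENNReal.ofReal (2 * M ^ 2 / f M) * fDivE f μ ν := by
        rw [lintegral_add_left measurable_const, lintegral_const_mul' _ _ ENNReal.ofReal_ne_top]
        simp [fDivE]
end
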